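/- arXiv:1408.1815 — 5 statements merged into one kernel-verified Lean document; each statement's English description precedes it below -/
import Mathlib

section
/- Let d ≥ 1, let T be a measure preserving ℤ^d-action on a σ-finite standard measure space (X, μ), and let T̃ be the induced ℝ^d-action on ([0,1)^d × X, Leb × μ). Then a line θ ∈ P(ℝ^d) is a rigid direction for T if and only if θ is a rigid direction for T̃; that is, 𝓡i(T) = 𝓡i(T̃). -/
open MeasureTheory Filter Set Topology

noncomputable section

instance {d : ℕ} : TopologicalSpace (Projectivization ℝ (Fin d → ℝ)) :=
  inferInstanceAs (TopologicalSpace (Quotient _))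

/-- The coordinatewise cast of an integer vector to a real vector. -/
def zcast {d : ℕ} (γ : Fin d → ℤ) : Fin d → ℝ := fun i => (γ i : ℝ)

/-- `T` is a measure preserving `ℤ^d`-action on `(X, μ)`. -/
def IsMPAction {d : ℕ} {X : Type*} [MeasurableSpace X] (μ : Measure X)
    (T : (Fin d → ℤ) → X ≃ᵐ X) : Prop :=
  (∀ γ γ' : Fin d → ℤ, ∀ x : X, T (γ + γ') x = T γ (T γ' x)) ∧
    ∀ γ : Fin d → ℤ, MeasurePreserving (T γ) μ μ

/-- The action `T` is free. -/
def IsFreeAction {d : ℕ} {X : Type*} [MeasurableSpace X] (μ : Measure X)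
    (T : (Fin d → ℤ) → X ≃ᵐ X) : Prop :=
  ∀ γ : Fin d → ℤ, γ ≠ 0 → ∀ᵐ x ∂μ, T γ x ≠ x

/-- `T` is recurrent along the line `θ ∈ P(ℝ^d)`. -/
def RecurrentAlong {d : ℕ} {X : Type*} [MeasurableSpace X] (μ : Measure X)
    (T : (Fin d → ℤ) → X ≃ᵐ X) (θ : Projectivization ℝ (Fin d → ℝ)) : Prop :=
  ∀ ε : ℝ, 0 < ε → ∀ A : Set X, MeasurableSet A → 0 < μ A →
    ∃ γ : Fin d → ℤ, γ ≠ 0 ∧ ∃ v ∈ θ.submodule, ‖zcast γ - v‖ < ε ∧ 0 < μ (A ∩ T γ '' A)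

/-- The set of recurrent directions `𝓡(T)`. -/
def recSet {d : ℕ} {X : Type*} [MeasurableSpace X] (μ : Measure X)
    (T : (Fin d → ℤ) → X ≃ᵐ X) : Set (Projectivization ℝ (Fin d → ℝ)) :=
  {θ | RecurrentAlong μ T θ}

/-- `T` is rigid along the line `θ ∈ P(ℝ^d)`. -/
def RigidAlong {d : ℕ} {X : Type*} [MeasurableSpace X] (μ : Measure X)
    (T : (Fin d → ℤ) → X ≃ᵐ X) (θ : Projectivization ℝ (Fin d → ℝ)) : Prop :=
  ∃ γ : ℕ → Fin d → ℤ,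
    Tendsto (fun n => ‖zcast (γ n)‖) atTop atTop ∧
    Tendsto (fun n => Metric.infDist (zcast (γ n)) ((θ.submodule : Set (Fin d → ℝ)))) atTop (𝓝 0) ∧
    ∀ A : Set X, MeasurableSet A → μ A < ⊤ →
      Tendsto (fun n => μ (A ∩ T (γ n) '' A)) atTop (𝓝 (μ A))

/-- The set of rigid directions `𝓡i(T)`. -/
def rigSet {d : ℕ} {X : Type*} [MeasurableSpace X] (μ : Measure X)
    (T : (Fin d → ℤ) → X ≃ᵐ X) : Set (Projectivization ℝ (Fin d → ℝ)) :=
  {θ | RigidAlong μ T θ}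

/-- The measure `Leb × μ` on `[0,1)^d × X`. -/
def indMeasure {d : ℕ} {X : Type*} [MeasurableSpace X] (μ : Measure X) :
    Measure ((Fin d → ℝ) × X) :=
  (Measure.pi fun _ : Fin d => (volume : Measure ℝ).restrict (Set.Ico 0 1)).prod μ

/-- The induced `ℝ^d`-action `T̃_t(y, x) = ({t+y}, T_{[t+y]} x)`. -/
def indMap {d : ℕ} {X : Type*} [MeasurableSpace X] (T : (Fin d → ℤ) → X ≃ᵐ X)
    (t : Fin d → ℝ) : (Fin d → ℝ) × X → (Fin d → ℝ) × X :=
  fun p => (fun i => Int.fract (t i + p.1 i), T (fun i => ⌊t i + p.1 i⌋) p.2)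

/-- A one-parameter flow `F` on `(Y, ν)` is conservative. -/
def FlowConservative {Y : Type*} [MeasurableSpace Y] (ν : Measure Y) (F : ℝ → Y → Y) : Prop :=
  ∀ B : Set Y, MeasurableSet B → 0 < ν B → ∀ K : Set ℝ, IsCompact K →
    ∃ s : ℝ, s ∉ K ∧ 0 < ν (B ∩ F s '' B)

/-- A one-parameter flow `F` on `(Y, ν)` is rigid. -/
def FlowRigid {Y : Type*} [MeasurableSpace Y] (ν : Measure Y) (F : ℝ → Y → Y) : Prop :=
  ∃ s : ℕ → ℝ, Tendsto s atTop atTop ∧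
    ∀ B : Set Y, MeasurableSet B → ν B < ⊤ →
      Tendsto (fun n => ν (B ∩ F (s n) '' B)) atTop (𝓝 (ν B))

/-- An `ℝ^d`-action `R` on `(Y, ν)` is recurrent along the line `θ`: the flow along some
(equivalently, every) nonzero vector of `θ` is conservative. -/
def ActionRecurrentAlong {d : ℕ} {Y : Type*} [MeasurableSpace Y] (ν : Measure Y)
    (R : (Fin d → ℝ) → Y → Y) (θ : Projectivization ℝ (Fin d → ℝ)) : Prop :=
  ∃ v ∈ θ.submodule, v ≠ (0 : Fin d → ℝ) ∧ FlowConservative ν (fun s => R (s • v))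

/-- An `ℝ^d`-action `R` on `(Y, ν)` is rigid along the line `θ`. -/
def ActionRigidAlong {d : ℕ} {Y : Type*} [MeasurableSpace Y] (ν : Measure Y)
    (R : (Fin d → ℝ) → Y → Y) (θ : Projectivization ℝ (Fin d → ℝ)) : Prop :=
  ∃ v ∈ θ.submodule, v ≠ (0 : Fin d → ℝ) ∧ FlowRigid ν (fun s => R (s • v))

section AsymptoticallyInvariant

variable {Ω : Type*} [MeasurableSpace Ω] {ν : Measure Ω}

theorem tendsto_measure_inter_iff {B : Set Ω} (hfin : ν B ≠ ⊤) {P : ℕ → Set Ω}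
    (hP : ∀ n, MeasurableSet (P n)) :
    Tendsto (fun n => ν (B ∩ P n)) atTop (𝓝 (ν B)) ↔
      Tendsto (fun n => ν (B \ P n)) atTop (𝓝 0) := by
  have hadd : ∀ n, ν (B ∩ P n) + ν (B \ P n) = ν B := fun n => measure_inter_add_sdiff B (hP n)
  have h1 : ∀ n, ν (B ∩ P n) ≠ ⊤ := fun n => measure_ne_top_of_subset inter_subset_left hfin
  have h2 : ∀ n, ν (B \ P n) ≠ ⊤ := fun n => measure_ne_top_of_subset sdiff_subset hfin
  constructor
  · intro h
    have : ∀ n, ν (B \ P n) = ν B - ν (B ∩ P n) := fun n => by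
      rw [← hadd n, ENNReal.add_sub_cancel_left (h1 n)]
    simp_rw [this]
    simpa using ENNReal.Tendsto.sub (tendsto_const_nhds (x := ν B)) h (Or.inl hfin)
  · intro h
    have : ∀ n, ν (B ∩ P n) = ν B - ν (B \ P n) := fun n => by
      rw [← hadd n, ENNReal.add_sub_cancel_right (h2 n)]
    simp_rw [this]
    simpa using ENNReal.Tendsto.sub (tendsto_const_nhds (x := ν B)) h (Or.inl hfin)

/-- The set `B` is asymptotically invariant under the sequence of maps `F`. -/
def AsympInvariant (ν : Measure Ω) (F : ℕ → Ω → Ω) (B : Set Ω) : Prop :=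
  Tendsto (fun n => ν (B \ F n ⁻¹' B)) atTop (𝓝 0)

theorem asympInvariant_empty (F : ℕ → Ω → Ω) : AsympInvariant ν F ∅ := by
  simp [AsympInvariant]

theorem AsympInvariant.diff {F : ℕ → Ω → Ω} (hF : ∀ n, MeasurePreserving (F n) ν ν)
    {W B : Set Ω} (hB : MeasurableSet B) (hBfin : ν B ≠ ⊤)
    (hWi : AsympInvariant ν F W) (hBi : AsympInvariant ν F B) :
    AsympInvariant ν F (W \ B) := by
  have key : ∀ n, ν (F n ⁻¹' B \ B) = ν (B \ F n ⁻¹' B) := fun n => by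
    have hm : MeasurableSet (F n ⁻¹' B) := (hF n).measurable hB
    have hmeas : ν (F n ⁻¹' B) = ν B := (hF n).measure_preimage hB.nullMeasurableSet
    rw [measure_sdiff' _ hB.nullMeasurableSet hBfin,
      measure_sdiff' _ hm.nullMeasurableSet (by rwa [hmeas]), hmeas, union_comm]
  have hsum := hWi.add hBi
  rw [add_zero] at hsum
  refine tendsto_of_tendsto_of_tendsto_of_le_of_le tendsto_const_nhds hsum
    (fun _ => zero_le) fun n => ?_
  calc ν ((W \ B) \ F n ⁻¹' (W \ B)) ≤ ν ((W \ F n ⁻¹' W) ∪ (F n ⁻¹' B \ B)) := by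
        apply measure_mono
        rintro x ⟨⟨hxW, hxB⟩, hx⟩
        by_cases h : F n x ∈ W
        · right
          refine ⟨?_, hxB⟩
          by_contra h'
          exact hx ⟨h, h'⟩
        · exact Or.inl ⟨hxW, h⟩
    _ ≤ ν (W \ F n ⁻¹' W) + ν (F n ⁻¹' B \ B) := measure_union_le _ _
    _ = _ := by rw [key]

theorem AsympInvariant.iUnion {F : ℕ → Ω → Ω} {f : ℕ → Set Ω}
    (hdisj : Pairwise (Function.onFun Disjoint f)) (hf : ∀ i, MeasurableSet (f i))
    (hfin : ν (⋃ i, f i) ≠ ⊤) (h : ∀ i, AsympInvariant ν F (f i)) :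
    AsympInvariant ν F (⋃ i, f i) := by
  have hlim : Tendsto (fun n => ∑' i, ν (f i \ F n ⁻¹' f i)) atTop (𝓝 0) := by
    have := tendsto_lintegral_of_dominated_convergence (μ := (Measure.count : Measure ℕ))
      (F := fun n i => ν (f i \ F n ⁻¹' f i)) (f := fun _ => 0) (fun i => ν (f i))
      (fun n => measurable_of_countable _)
      (fun n => ae_of_all _ fun i => measure_mono sdiff_subset)
      (by rwa [lintegral_count, ← measure_iUnion hdisj hf]) (ae_of_all _ fun i => h i)
    simpa [lintegral_count] using this
  refine tendsto_of_tendsto_of_tendsto_of_le_of_le tendsto_const_nhds hlim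
    (fun _ => zero_le) fun n => ?_
  refine (measure_mono ?_).trans (measure_iUnion_le _)
  rintro x ⟨hx, hx'⟩
  obtain ⟨i, hi⟩ := mem_iUnion.1 hx
  exact mem_iUnion.2 ⟨i, hi, fun hi' => hx' (mem_iUnion.2 ⟨i, hi'⟩)⟩

/-- If open-by-measurable rectangles of finite measure are asymptotically invariant, so are all
sets of finite measure. -/
theorem asympInvariant_of_prod {Y X : Type*} [TopologicalSpace Y] [MeasurableSpace Y]
    [BorelSpace Y] [MeasurableSpace X] {l : Measure Y} [IsFiniteMeasure l] {μ : Measure X}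
    [SigmaFinite μ] {F : ℕ → Y × X → Y × X}
    (hF : ∀ n, MeasurePreserving (F n) (l.prod μ) (l.prod μ))
    (h : ∀ C : Set Y, IsOpen C → ∀ A : Set X, MeasurableSet A → μ A ≠ ⊤ →
      AsympInvariant (l.prod μ) F (C ×ˢ A))
    {B : Set (Y × X)} (hB : MeasurableSet B) (hBfin : l.prod μ B ≠ ⊤) :
    AsympInvariant (l.prod μ) F B := by
  have local_case : ∀ S : Set X, MeasurableSet S → μ S ≠ ⊤ →
      AsympInvariant (l.prod μ) F (B ∩ univ ×ˢ S) := by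
    intro S hS hSfin
    have hWm : MeasurableSet ((univ : Set Y) ×ˢ S) := MeasurableSet.univ.prod hS
    have hWfin : l.prod μ ((univ : Set Y) ×ˢ S) ≠ ⊤ := by
      rw [Measure.prod_prod]
      exact ENNReal.mul_ne_top (measure_ne_top _ _) hSfin
    have hgen : (Prod.instMeasurableSpace : MeasurableSpace (Y × X)) =
        MeasurableSpace.generateFrom
          (image2 (· ×ˢ ·) {C : Set Y | IsOpen C} {A : Set X | MeasurableSet A}) := by
      rw [← generateFrom_prod_eq (C := {C : Set Y | IsOpen C})
        ⟨fun _ => univ, fun _ => isOpen_univ, iUnion_const _⟩ isCountablySpanning_measurableSet,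
        MeasurableSpace.generateFrom_measurableSet,
        BorelSpace.measurable_eq (α := Y)]
    refine MeasurableSpace.induction_on_inter
      (C := fun B _ => AsympInvariant (l.prod μ) F (B ∩ univ ×ˢ S)) hgen
      (isPiSystem_isOpen.prod MeasurableSpace.isPiSystem_measurableSet) ?_ ?_ ?_ ?_ B hB
    · simpa using asympInvariant_empty F
    · rintro _ ⟨C, hC, A, hA, rfl⟩
      rw [prod_inter_prod, inter_univ]
      exact h C hC _ (hA.inter hS) (measure_ne_top_of_subset inter_subset_right hSfin)
    · intro t ht hti
      have : tᶜ ∩ (univ : Set Y) ×ˢ S = univ ×ˢ S \ (t ∩ univ ×ˢ S) := by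
        ext; simp; tauto
      rw [this]
      exact AsympInvariant.diff hF (ht.inter hWm)
        (measure_ne_top_of_subset inter_subset_right hWfin) (h _ isOpen_univ S hS hSfin) hti
    · intro f hd hf hfi
      rw [iUnion_inter]
      refine AsympInvariant.iUnion
        (fun i j hij => (hd hij).mono inter_subset_left inter_subset_left)
        (fun i => (hf i).inter hWm) (measure_ne_top_of_subset ?_ hWfin) hfi
      exact iUnion_subset fun _ => inter_subset_right
  have hBU : B = ⋃ i, B ∩ univ ×ˢ disjointed (spanningSets μ) i := by
    rw [← inter_iUnion, ← prod_iUnion, iUnion_disjointed, iUnion_spanningSets, univ_prod_univ,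
      inter_univ]
  have hSm : ∀ i, MeasurableSet (disjointed (spanningSets μ) i) :=
    .disjointed (measurableSet_spanningSets μ)
  rw [hBU]
  refine AsympInvariant.iUnion (fun i j hij => ?_)
    (fun i => hB.inter (MeasurableSet.univ.prod (hSm i))) (by rwa [← hBU])
    fun i => local_case _ (hSm i) ?_
  · refine Disjoint.mono inter_subset_right inter_subset_right ?_
    exact Set.disjoint_prod.2 (Or.inr (disjoint_disjointed _ hij))
  · exact measure_ne_top_of_subset (disjointed_subset _ _) (measure_spanningSets_lt_top μ i).ne

end AsymptoticallyInvariant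

section UnitCube

theorem measurePreserving_fract_add (t : ℝ) :
    MeasurePreserving (fun y : ℝ => Int.fract (t + y))
      ((volume : Measure ℝ).restrict (Ico 0 1)) ((volume : Measure ℝ).restrict (Ico 0 1)) := by
  have hm : Measurable fun y : ℝ => Int.fract (t + y) := (measurable_const_add t).fract
  refine ⟨hm, Measure.ext fun S hS => ?_⟩
  rw [Measure.map_apply hm hS, Measure.restrict_congr_set Ico_ae_eq_Ioc,
    Measure.restrict_apply (hm hS)]
  have hU : MeasurableSet (Int.fract ⁻¹' S : Set ℝ) := measurable_fract hS
  have h1 : (fun y : ℝ => Int.fract (t + y)) ⁻¹' S ∩ Ioc 0 1 =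
      (fun y => t + y) ⁻¹' (Int.fract ⁻¹' S ∩ Ioc t (t + 1)) := by
    ext y; simp [add_comm t]
  have hinv : ∀ g : AddSubgroup.zmultiples (1 : ℝ),
      (fun x : ℝ => g +ᵥ x) ⁻¹' (Int.fract ⁻¹' S) = Int.fract ⁻¹' S := by
    rintro ⟨_, n, rfl⟩
    ext x
    simp [AddSubgroup.vadd_def]
  have h2 := (isAddFundamentalDomain_Ioc one_pos t).measure_set_eq
    (isAddFundamentalDomain_Ioc one_pos (0 : ℝ)) hU hinv
  rw [h1, measure_preimage_add, h2, zero_add, ← Measure.restrict_apply hU,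
    ← Measure.restrict_congr_set Ico_ae_eq_Ioc, Measure.restrict_apply hU,
    Measure.restrict_apply hS]
  congr 1
  ext y
  simp only [mem_inter_iff, mem_preimage, and_congr_left_iff]
  intro hy
  rw [Int.fract_eq_self.2 hy]

/-- Lebesgue measure on the unit cube. -/
def cubeMeasure (d : ℕ) : Measure (Fin d → ℝ) :=
  Measure.pi fun _ : Fin d => (volume : Measure ℝ).restrict (Ico 0 1)

instance : IsProbabilityMeasure ((volume : Measure ℝ).restrict (Ico 0 1)) :=
  ⟨by simp⟩

instance (d : ℕ) : IsProbabilityMeasure (cubeMeasure d) :=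
  inferInstanceAs (IsProbabilityMeasure (Measure.pi _))

theorem ae_cubeMeasure_mem_Ioo (d : ℕ) :
    ∀ᵐ y ∂cubeMeasure d, ∀ i, y i ∈ Ioo (0 : ℝ) 1 := by
  rw [ae_all_iff]
  intro i
  refine (measurePreserving_eval (fun _ : Fin d => (volume : Measure ℝ).restrict (Ico 0 1)) i)
    |>.quasiMeasurePreserving.ae (p := fun x => x ∈ Ioo (0 : ℝ) 1) ?_
  rw [Measure.restrict_congr_set Ioo_ae_eq_Ico.symm]
  exact ae_restrict_mem measurableSet_Ioo

theorem tendsto_cubeMeasure_diff_preimage_add {d : ℕ} {e : ℕ → Fin d → ℝ}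
    (he : Tendsto e atTop (𝓝 0)) {D : Set (Fin d → ℝ)} (hD : IsOpen D) :
    Tendsto (fun n => cubeMeasure d (D \ (fun y => e n + y) ⁻¹' D)) atTop (𝓝 0) := by
  have := tendsto_measure_of_ae_tendsto_indicator_of_isFiniteMeasure atTop
    (μ := cubeMeasure d) (A := ∅) (As := fun n => D \ (fun y => e n + y) ⁻¹' D)
    MeasurableSet.empty
    (fun n => hD.measurableSet.diff ((measurable_const_add (e n)) hD.measurableSet))
    (ae_of_all _ fun y => ?_)
  · simpa using this
  · by_cases hy : y ∈ D
    · have hlim : Tendsto (fun n => e n + y) atTop (𝓝 y) := by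
        simpa using he.add_const y
      filter_upwards [hlim.eventually (hD.mem_nhds hy)] with n hn
      have hn' : e n + y ∈ D := hn
      simp [hn']
    · simp [hy]

theorem ofReal_abs_sub_round_le (τ : ℝ) :
    ENNReal.ofReal |τ - round τ| ≤
      (volume : Measure ℝ).restrict (Ico 0 1) {y | y < 1 / 2 ∧ 1 / 2 ≤ Int.fract (τ + y)} := by
  set δ := τ - round τ with hδ
  have hfr : ∀ y, Int.fract (τ + y) = Int.fract (δ + y) := fun y => by
    have : τ + y = δ + y + (round τ : ℤ) := by rw [hδ]; ring
    rw [this, Int.fract_add_intCast]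
  have habs := abs_le.1 (abs_sub_round τ)
  rw [← hδ] at habs
  rcases lt_or_ge δ 0 with h | h
  · calc ENNReal.ofReal |δ| = volume (Ico 0 (-δ)) := by rw [abs_of_neg h]; simp
      _ = (volume : Measure ℝ).restrict (Ico 0 1) (Ico 0 (-δ)) := by
        rw [Measure.restrict_eq_self _ (Ico_subset_Ico_right (by linarith))]
      _ ≤ _ := by
        refine measure_mono fun y hy => ⟨by linarith [hy.2], ?_⟩
        have : Int.fract (δ + y) = δ + y + 1 := by
          rw [← Int.fract_add_one]
          exact Int.fract_eq_self.2 ⟨by linarith [hy.1], by linarith [hy.2]⟩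
        rw [hfr, this]
        linarith [hy.1]
  · calc ENNReal.ofReal |δ| = volume (Ico (1 / 2 - δ) (1 / 2)) := by rw [abs_of_nonneg h]; simp
      _ = (volume : Measure ℝ).restrict (Ico 0 1) (Ico (1 / 2 - δ) (1 / 2)) := by
        rw [Measure.restrict_eq_self _ (Ico_subset_Ico (by linarith) (by norm_num))]
      _ ≤ _ := by
        refine measure_mono fun y hy => ⟨hy.2, ?_⟩
        rw [hfr, Int.fract_eq_self.2 ⟨by linarith [hy.1], by linarith [hy.2]⟩]
        linarith [hy.1]

theorem ofReal_abs_sub_round_le_cubeMeasure {d : ℕ} (u : Fin d → ℝ) (i : Fin d) :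
    ENNReal.ofReal |u i - round (u i)| ≤
      cubeMeasure d {y | y i < 1 / 2 ∧ 1 / 2 ≤ Int.fract (u i + y i)} := by
  refine (ofReal_abs_sub_round_le (u i)).trans (le_of_eq ?_)
  have hm : MeasurableSet {y : ℝ | y < 1 / 2 ∧ 1 / 2 ≤ Int.fract (u i + y)} :=
    measurableSet_Iio.inter
      (measurableSet_le measurable_const (measurable_const_add (u i)).fract)
  exact ((measurePreserving_eval (fun _ : Fin d => (volume : Measure ℝ).restrict (Ico 0 1))
    i).measure_preimage hm.nullMeasurableSet).symm

theorem cubeMeasure_pi_Ioo_ne_zero (d : ℕ) :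
    cubeMeasure d (univ.pi fun _ => Ioo (1 / 4) (3 / 4)) ≠ 0 := by
  rw [cubeMeasure, Measure.pi_pi, Finset.prod_ne_zero_iff]
  intro i _
  rw [Measure.restrict_eq_self _ (Ioo_subset_Ico_self.trans
    (Ico_subset_Ico (by norm_num) (by norm_num))), Real.volume_Ioo]
  norm_num

end UnitCube

section Integer

variable {d : ℕ}

/-- Coordinatewise rounding of a real vector. -/
def roundVec (u : Fin d → ℝ) : Fin d → ℤ := fun i => round (u i)

theorem zcast_neg (γ : Fin d → ℤ) : zcast (-γ) = -zcast γ := by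
  ext i; simp [zcast]

/-- Returns to the integer lattice along the line spanned by `v`. -/
theorem exists_tendsto_zcast_sub_smul (v : Fin d → ℝ) :
    ∃ (s : ℕ → ℝ) (γ : ℕ → Fin d → ℤ), Tendsto s atTop atTop ∧
      Tendsto (fun n => zcast (γ n) - s n • v) atTop (𝓝 0) := by
  obtain ⟨c, -, φ, hφ, hc⟩ := (isCompact_univ_pi fun _ : Fin d =>
    isCompact_Icc (a := (0 : ℝ)) (b := 1)).tendsto_subseq
    (x := fun n : ℕ => fun i => Int.fract (n * v i))
    (fun n i _ => ⟨Int.fract_nonneg _, (Int.fract_lt_one _).le⟩)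
  have hge : ∀ m n, φ m + n ≤ φ (m + n) := fun m n => by
    induction n with
    | zero => simp
    | succ n ih =>
      have := hφ (Nat.lt_succ_self (m + n))
      rw [Nat.succ_eq_add_one] at this
      change φ m + (n + 1) ≤ φ (m + n + 1)
      omega
  refine ⟨fun n => (φ (n + n) : ℝ) - φ n,
    fun n i => ⌊(φ (n + n) : ℝ) * v i⌋ - ⌊(φ n : ℝ) * v i⌋, ?_, ?_⟩
  · refine tendsto_atTop_mono (fun n => ?_) tendsto_natCast_atTop_atTop
    have : ((φ n + n : ℕ) : ℝ) ≤ φ (n + n) := by exact_mod_cast hge n n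
    push_cast at this
    linarith
  · have hdbl : Tendsto (fun n : ℕ => n + n) atTop atTop :=
      tendsto_atTop_mono (fun n => Nat.le_add_left n n) tendsto_id
    have := hc.sub (hc.comp hdbl)
    rw [sub_self] at this
    refine this.congr fun n => ?_
    ext i
    simp only [Function.comp_apply, Pi.sub_apply, Pi.smul_apply, zcast, smul_eq_mul, Int.fract]
    push_cast
    ring

theorem tendsto_norm_zcast {v : Fin d → ℝ} (hv : v ≠ 0) {s : ℕ → ℝ} {γ : ℕ → Fin d → ℤ}
    (hs : Tendsto s atTop atTop)
    (hγ : Tendsto (fun n => zcast (γ n) - s n • v) atTop (𝓝 0)) :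
    Tendsto (fun n => ‖zcast (γ n)‖) atTop atTop := by
  have h1 : Tendsto (fun n => s n * ‖v‖ + -‖zcast (γ n) - s n • v‖) atTop atTop :=
    (hs.atTop_mul_const (norm_pos_iff.2 hv)).atTop_add (C := -0) (by simpa using hγ.norm.neg)
  refine tendsto_atTop_mono (fun n => ?_) h1
  have h2 := norm_sub_norm_le (s n • v) (s n • v - zcast (γ n))
  rw [sub_sub_cancel, norm_smul, norm_sub_rev (s n • v), Real.norm_eq_abs] at h2
  have h3 : s n * ‖v‖ ≤ |s n| * ‖v‖ := by gcongr; exact le_abs_self _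
  linarith

theorem tendsto_infDist_zcast {v : Fin d → ℝ} {θ : Submodule ℝ (Fin d → ℝ)} (hv : v ∈ θ)
    {s : ℕ → ℝ} {γ : ℕ → Fin d → ℤ}
    (hγ : Tendsto (fun n => zcast (γ n) - s n • v) atTop (𝓝 0)) :
    Tendsto (fun n => Metric.infDist (zcast (γ n)) (θ : Set (Fin d → ℝ))) atTop (𝓝 0) := by
  refine squeeze_zero (fun _ => Metric.infDist_nonneg) (fun n => ?_) (by simpa using hγ.norm)
  rw [← dist_eq_norm]
  exact Metric.infDist_le_dist_of_mem (θ.smul_mem _ hv)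

/-- Integer points approaching the line spanned by `v` and escaping to infinity can, up to sign,
be approximated by points `s n • v` with `s n → ∞`. -/
theorem exists_smul_approx {v : Fin d → ℝ} {γ : ℕ → Fin d → ℤ}
    (h1 : Tendsto (fun n => ‖zcast (γ n)‖) atTop atTop)
    (h2 : Tendsto (fun n => Metric.infDist (zcast (γ n))
      ((Submodule.span ℝ {v} : Submodule ℝ (Fin d → ℝ)) : Set (Fin d → ℝ))) atTop (𝓝 0)) :
    ∃ (s : ℕ → ℝ) (γ' : ℕ → Fin d → ℤ), Tendsto s atTop atTop ∧
      (∀ n, γ' n = γ n ∨ γ' n = -γ n) ∧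
      Tendsto (fun n => zcast (γ' n) - s n • v) atTop (𝓝 0) := by
  have hex : ∀ n : ℕ, ∃ a : ℝ, ‖zcast (γ n) - a • v‖ < Metric.infDist (zcast (γ n))
      ((Submodule.span ℝ {v} : Submodule ℝ (Fin d → ℝ)) : Set (Fin d → ℝ)) + 1 / (n + 1) := by
    intro n
    obtain ⟨c, hc, hlt⟩ := (Metric.infDist_lt_iff (x := zcast (γ n))
      (s := ((Submodule.span ℝ {v} : Submodule ℝ (Fin d → ℝ)) : Set (Fin d → ℝ)))
      ⟨0, Submodule.zero_mem _⟩).1 (lt_add_of_pos_right _ (Nat.one_div_pos_of_nat (n := n)))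
    obtain ⟨a, rfl⟩ := Submodule.mem_span_singleton.1 hc
    exact ⟨a, by rwa [← dist_eq_norm]⟩
  choose a ha using hex
  have hnorm : Tendsto (fun n => ‖zcast (γ n) - a n • v‖) atTop (𝓝 0) := by
    refine squeeze_zero (fun _ => norm_nonneg _) (fun n => (ha n).le) ?_
    simpa using h2.add tendsto_one_div_add_atTop_nhds_zero_nat
  have habs : Tendsto (fun n => |a n|) atTop atTop := by
    have hmul : Tendsto (fun n => ‖v‖ * |a n|) atTop atTop := by
      refine tendsto_atTop_mono (fun n => ?_) (h1.atTop_add (C := -0) hnorm.neg)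
      have := norm_sub_norm_le (zcast (γ n)) (a n • v)
      rw [norm_smul, Real.norm_eq_abs, mul_comm] at this
      linarith
    have hv : 0 < ‖v‖ := by
      rcases (norm_nonneg v).eq_or_lt with h | h
      · exact absurd hmul (by simp [← h, tendsto_const_nhds.not_tendsto (disjoint_nhds_atTop _)])
      · exact h
    exact (tendsto_const_mul_atTop_of_pos hv).1 hmul
  refine ⟨fun n => |a n|, fun n => if 0 ≤ a n then γ n else -γ n, habs, fun n => ?_, ?_⟩
  · dsimp only
    split_ifs
    exacts [Or.inl rfl, Or.inr rfl]
  · refine tendsto_zero_iff_norm_tendsto_zero.2 (hnorm.congr fun n => ?_)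
    dsimp only
    split_ifs with h
    · rw [abs_of_nonneg h]
    · rw [abs_of_neg (not_le.1 h), zcast_neg, neg_smul, ← neg_sub', norm_neg]

end Integer

section Action

variable {d : ℕ} {X : Type*} [MeasurableSpace X] {μ : Measure X} {T : (Fin d → ℤ) → X ≃ᵐ X}

theorem IsMPAction.zero_apply (hT : IsMPAction μ T) (x : X) : T 0 x = x := by
  have := hT.1 0 0 x
  rw [add_zero] at this
  exact ((T 0).injective this).symm

theorem IsMPAction.neg_apply_apply (hT : IsMPAction μ T) (γ : Fin d → ℤ) (x : X) :
    T (-γ) (T γ x) = x := by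
  rw [← hT.1, neg_add_cancel, hT.zero_apply]

theorem IsMPAction.apply_neg_apply (hT : IsMPAction μ T) (γ : Fin d → ℤ) (x : X) :
    T γ (T (-γ) x) = x := by
  rw [← hT.1, add_neg_cancel, hT.zero_apply]

theorem IsMPAction.image_eq_preimage (hT : IsMPAction μ T) (γ : Fin d → ℤ) (A : Set X) :
    T γ '' A = T (-γ) ⁻¹' A :=
  image_eq_preimage_of_inverse (hT.neg_apply_apply γ) (hT.apply_neg_apply γ) ▸ rfl

theorem IsMPAction.measure_diff_preimage_neg (hT : IsMPAction μ T) (γ : Fin d → ℤ) {A : Set X}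
    (hA : MeasurableSet A) (hfin : μ A ≠ ⊤) :
    μ (A \ T (-γ) ⁻¹' A) = μ (A \ T γ ⁻¹' A) := by
  have hm : ∀ γ, MeasurableSet (T γ ⁻¹' A) := fun γ => (T γ).measurable hA
  have hint : μ (A ∩ T (-γ) ⁻¹' A) = μ (A ∩ T γ ⁻¹' A) := by
    rw [← (hT.2 γ).measure_preimage (hA.inter (hm _)).nullMeasurableSet]
    congr 1
    ext x
    simp [hT.neg_apply_apply, and_comm]
  rw [← sdiff_inter_self_eq_sdiff, ← sdiff_inter_self_eq_sdiff (t := T γ ⁻¹' A),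
    inter_comm, inter_comm (T γ ⁻¹' A),
    measure_sdiff inter_subset_left (hA.inter (hm _)).nullMeasurableSet
      (measure_ne_top_of_subset inter_subset_left hfin),
    measure_sdiff inter_subset_left (hA.inter (hm _)).nullMeasurableSet
      (measure_ne_top_of_subset inter_subset_left hfin), hint]

/-- Rigidity of `T` along a sequence of integer vectors, in terms of preimages. -/
theorem IsMPAction.tendsto_inter_image_iff (hT : IsMPAction μ T) (γ : ℕ → Fin d → ℤ) {A : Set X}
    (hA : MeasurableSet A) (hfin : μ A ≠ ⊤) :
    Tendsto (fun n => μ (A ∩ T (γ n) '' A)) atTop (𝓝 (μ A)) ↔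
      AsympInvariant μ (fun n => T (-γ n)) A := by
  simp_rw [hT.image_eq_preimage]
  exact tendsto_measure_inter_iff hfin fun n => (T _).measurable hA

theorem measurable_indMap_snd (T : (Fin d → ℤ) → X ≃ᵐ X) (u : Fin d → ℝ) :
    Measurable (fun p : (Fin d → ℝ) × X => T (fun i => ⌊u i + p.1 i⌋) p.2) := by
  have h1 : Measurable fun q : (Fin d → ℤ) × X => T q.1 q.2 :=
    measurable_from_prod_countable_right fun γ => (T γ).measurable
  have h2 : Measurable fun p : (Fin d → ℝ) × X => ((fun i => ⌊u i + p.1 i⌋ : Fin d → ℤ), p.2) := by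
    refine Measurable.prodMk (measurable_pi_lambda _ fun i => ?_) measurable_snd
    have h3 : Measurable fun p : (Fin d → ℝ) × X => p.1 i :=
      (measurable_pi_apply i).comp measurable_fst
    exact (h3.const_add (u i)).floor
  exact h1.comp h2

theorem IsMPAction.measurePreserving_indMap [SigmaFinite μ] (hT : IsMPAction μ T) (u : Fin d → ℝ) :
    MeasurePreserving (indMap T u) ((cubeMeasure d).prod μ) ((cubeMeasure d).prod μ) := by
  have h1 : MeasurePreserving (fun (y : Fin d → ℝ) i => Int.fract (u i + y i))
      (cubeMeasure d) (cubeMeasure d) :=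
    measurePreserving_pi _ _ fun i => measurePreserving_fract_add (u i)
  exact h1.skew_product (g := fun y x => T (fun i => ⌊u i + y i⌋) x) (measurable_indMap_snd T u)
    (ae_of_all _ fun y => (hT.2 _).map_eq)

theorem IsMPAction.indMap_indMap_neg (hT : IsMPAction μ T) (u : Fin d → ℝ)
    {p : (Fin d → ℝ) × X} (hp : ∀ i, p.1 i ∈ Ico (0 : ℝ) 1) :
    indMap T u (indMap T (-u) p) = p := by
  have hsum : ∀ i, u i + Int.fract (-u i + p.1 i) = p.1 i - (⌊-u i + p.1 i⌋ : ℤ) := fun i => by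
    rw [Int.fract]; ring
  have hfloor : ∀ i, ⌊u i + Int.fract (-u i + p.1 i)⌋ = -⌊-u i + p.1 i⌋ := fun i => by
    rw [hsum, Int.floor_sub_intCast, Int.floor_eq_zero_iff.2 (hp i), zero_sub]
  have hfract : ∀ i, Int.fract (u i + Int.fract (-u i + p.1 i)) = p.1 i := fun i => by
    rw [hsum, Int.fract_sub_intCast, Int.fract_eq_self.2 (hp i)]
  refine Prod.ext (funext fun i => hfract i) ?_
  change T (fun i => ⌊u i + Int.fract (-u i + p.1 i)⌋) (T (fun i => ⌊-u i + p.1 i⌋) p.2) = p.2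
  simp_rw [hfloor]
  exact hT.neg_apply_apply _ _

theorem IsMPAction.indMap_neg_indMap (hT : IsMPAction μ T) (u : Fin d → ℝ)
    {p : (Fin d → ℝ) × X} (hp : ∀ i, p.1 i ∈ Ico (0 : ℝ) 1) :
    indMap T (-u) (indMap T u p) = p := by
  simpa using hT.indMap_indMap_neg (-u) hp

theorem ae_prod_mem_cube [SFinite μ] :
    ∀ᵐ p ∂(cubeMeasure d).prod μ, ∀ i, p.1 i ∈ Ioo (0 : ℝ) 1 :=
  Measure.quasiMeasurePreserving_fst.ae (ae_cubeMeasure_mem_Ioo d)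

/-- Rigidity of the induced action along a sequence of vectors, in terms of preimages. -/
theorem IsMPAction.tendsto_inter_indMap_image_iff [SigmaFinite μ] (hT : IsMPAction μ T)
    (u : ℕ → Fin d → ℝ) :
    (∀ B : Set ((Fin d → ℝ) × X), MeasurableSet B → indMeasure μ B < ⊤ →
      Tendsto (fun n => indMeasure μ (B ∩ indMap T (u n) '' B)) atTop (𝓝 (indMeasure μ B))) ↔
    ∀ B : Set ((Fin d → ℝ) × X), MeasurableSet B → (cubeMeasure d).prod μ B ≠ ⊤ →
      AsympInvariant ((cubeMeasure d).prod μ) (fun n => indMap T (-u n)) B := by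
  change (∀ B : Set ((Fin d → ℝ) × X), MeasurableSet B → (cubeMeasure d).prod μ B < ⊤ →
    Tendsto (fun n => (cubeMeasure d).prod μ (B ∩ indMap T (u n) '' B)) atTop
      (𝓝 ((cubeMeasure d).prod μ B))) ↔ _
  have hpre : ∀ {B : Set ((Fin d → ℝ) × X)}, MeasurableSet B → ∀ n,
      MeasurableSet (indMap T (-u n) ⁻¹' B) :=
    fun hB n => (hT.measurePreserving_indMap (-u n)).measurable hB
  have hIoo : ∀ {p : (Fin d → ℝ) × X}, (∀ i, p.1 i ∈ Ioo (0 : ℝ) 1) →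
      ∀ i, p.1 i ∈ Ico (0 : ℝ) 1 := fun hp i => Ioo_subset_Ico_self (hp i)
  constructor
  · intro h B hB hfin
    set Q : Set ((Fin d → ℝ) × X) := (univ.pi fun _ => Ioo (0 : ℝ) 1) ×ˢ univ with hQ
    have hQm : MeasurableSet Q :=
      (MeasurableSet.univ_pi fun _ => measurableSet_Ioo).prod MeasurableSet.univ
    have hQmem : ∀ {p : (Fin d → ℝ) × X}, p ∈ Q ↔ ∀ i, p.1 i ∈ Ioo (0 : ℝ) 1 := by
      intro p; simp [hQ]
    have hBQfin : (cubeMeasure d).prod μ (B ∩ Q) ≠ ⊤ :=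
      measure_ne_top_of_subset inter_subset_left hfin
    have hBQ : AsympInvariant ((cubeMeasure d).prod μ) (fun n => indMap T (-u n)) (B ∩ Q) := by
      refine (tendsto_measure_inter_iff hBQfin (hpre (hB.inter hQm))).1 ?_
      refine tendsto_of_tendsto_of_tendsto_of_le_of_le (h _ (hB.inter hQm) hBQfin.lt_top)
        tendsto_const_nhds (fun n => measure_mono ?_) (fun n => measure_mono inter_subset_left)
      rintro p ⟨hp, q, hq, rfl⟩
      refine ⟨hp, ?_⟩
      rw [mem_preimage, hT.indMap_neg_indMap (u n) (hIoo (hQmem.1 hq.2))]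
      exact hq
    refine tendsto_of_tendsto_of_tendsto_of_le_of_le tendsto_const_nhds hBQ
      (fun _ => zero_le) fun n => measure_mono_ae ?_
    filter_upwards [ae_prod_mem_cube (d := d) (μ := μ)] with p hp hpB
    exact ⟨⟨hpB.1, hQmem.2 hp⟩, fun h' => hpB.2 h'.1⟩
  · intro h B hB hfin
    refine tendsto_of_tendsto_of_tendsto_of_le_of_le
      ((tendsto_measure_inter_iff hfin.ne (hpre hB)).2 (h B hB hfin.ne))
      tendsto_const_nhds (fun n => measure_mono_ae ?_) (fun n => measure_mono inter_subset_left)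
    filter_upwards [ae_prod_mem_cube (d := d) (μ := μ)] with p hp hpB
    exact ⟨hpB.1, _, hpB.2, hT.indMap_indMap_neg (u n) (hIoo hp)⟩

theorem IsMPAction.asympInvariant_indMap [SigmaFinite μ] (hT : IsMPAction μ T)
    {k : ℕ → Fin d → ℤ} {u : ℕ → Fin d → ℝ}
    (hu : Tendsto (fun n => u n - zcast (k n)) atTop (𝓝 0))
    (hk : ∀ A : Set X, MeasurableSet A → μ A ≠ ⊤ → AsympInvariant μ (fun n => T (k n)) A)
    {B : Set ((Fin d → ℝ) × X)} (hB : MeasurableSet B) (hfin : (cubeMeasure d).prod μ B ≠ ⊤) :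
    AsympInvariant ((cubeMeasure d).prod μ) (fun n => indMap T (u n)) B := by
  refine asympInvariant_of_prod (fun n => hT.measurePreserving_indMap (u n)) ?_ hB hfin
  intro C hC A hA hAfin
  set e : ℕ → Fin d → ℝ := fun n => u n - zcast (k n) with he
  set D : Set (Fin d → ℝ) := C ∩ univ.pi fun _ => Ioo (0 : ℝ) 1 with hD
  have hDo : IsOpen D := hC.inter (isOpen_set_pi finite_univ fun _ _ => isOpen_Ioo)
  have hlim := (ENNReal.Tendsto.mul_const (b := μ A)
    (tendsto_cubeMeasure_diff_preimage_add hu hDo) (Or.inr hAfin)).add (hk A hA hAfin)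
  rw [zero_mul, add_zero] at hlim
  refine tendsto_of_tendsto_of_tendsto_of_le_of_le tendsto_const_nhds hlim
    (fun _ => zero_le) fun n => ?_
  calc (cubeMeasure d).prod μ (C ×ˢ A \ indMap T (u n) ⁻¹' C ×ˢ A)
      ≤ (cubeMeasure d).prod μ ((D \ (fun y => e n + y) ⁻¹' D) ×ˢ A ∪
          univ ×ˢ (A \ T (k n) ⁻¹' A)) := by
        refine measure_mono_ae ?_
        filter_upwards [ae_prod_mem_cube (d := d) (μ := μ)] with p hp hpB
        obtain ⟨⟨hpC, hpA⟩, hnot⟩ := hpB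
        by_cases hin : e n + p.1 ∈ D
        · refine Or.inr ⟨mem_univ _, hpA, fun hTA => hnot ?_⟩
          have hmem : ∀ i, (e n + p.1) i ∈ Ioo (0 : ℝ) 1 := fun i => hin.2 i (mem_univ i)
          have hsum : ∀ i, u n i + p.1 i = (e n + p.1) i + (k n i : ℤ) := fun i => by
            simp only [he, zcast, Pi.add_apply, Pi.sub_apply]; ring
          have hfr : (fun i => Int.fract (u n i + p.1 i)) = e n + p.1 := by
            ext i
            rw [hsum, Int.fract_add_intCast, Int.fract_eq_self.2 (Ioo_subset_Ico_self (hmem i))]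
          have hfl : (fun i => ⌊u n i + p.1 i⌋) = k n := by
            ext i
            rw [hsum, Int.floor_add_intCast,
              Int.floor_eq_zero_iff.2 (Ioo_subset_Ico_self (hmem i)), zero_add]
          change (fun i => Int.fract (u n i + p.1 i)) ∈ C ∧ T (fun i => ⌊u n i + p.1 i⌋) p.2 ∈ A
          rw [hfr, hfl]
          exact ⟨hin.1, hTA⟩
        · exact Or.inl ⟨⟨⟨hpC, fun i _ => hp i⟩, hin⟩, hpA⟩
    _ ≤ _ := (measure_union_le _ _).trans (by
        rw [Measure.prod_prod, Measure.prod_prod, measure_univ, one_mul])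

theorem asympInvariant_of_indMap [SigmaFinite μ]
    {k : ℕ → Fin d → ℤ} {u : ℕ → Fin d → ℝ}
    (hu : Tendsto (fun n => u n - zcast (k n)) atTop (𝓝 0)) {A : Set X}
    (h : AsympInvariant ((cubeMeasure d).prod μ) (fun n => indMap T (u n)) (univ ×ˢ A)) :
    AsympInvariant μ (fun n => T (k n)) A := by
  set M : Set (Fin d → ℝ) := univ.pi fun _ => Ioo (1 / 4) (3 / 4)
  have hM0 : cubeMeasure d M ≠ 0 := cubeMeasure_pi_Ioo_ne_zero d
  have hlim := ENNReal.Tendsto.const_mul (a := (cubeMeasure d M)⁻¹) h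
    (Or.inr (ENNReal.inv_ne_top.2 hM0))
  rw [mul_zero] at hlim
  refine tendsto_of_tendsto_of_tendsto_of_le_of_le' tendsto_const_nhds hlim
    (Eventually.of_forall fun _ => zero_le) ?_
  have hsmall : ∀ᶠ n in atTop, ‖u n - zcast (k n)‖ < 1 / 4 :=
    (tendsto_zero_iff_norm_tendsto_zero.1 hu).eventually (gt_mem_nhds (by norm_num))
  filter_upwards [hsmall] with n hn
  rw [← ENNReal.mul_le_iff_le_inv hM0 (measure_ne_top _ _), ← Measure.prod_prod]
  refine measure_mono ?_
  rintro ⟨y, x⟩ ⟨hy, hxA, hx⟩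
  refine ⟨⟨mem_univ _, hxA⟩, fun hmem => hx ?_⟩
  have hfl : (fun i => ⌊u n i + y i⌋) = k n := by
    ext i
    have h1 := hy i (mem_univ i)
    have h2 := abs_lt.1 ((norm_le_pi_norm (u n - zcast (k n)) i).trans_lt hn)
    simp only [Pi.sub_apply, zcast] at h2
    rw [Int.floor_eq_iff]
    constructor <;> linarith [h1.1, h1.2, h2.1, h2.2]
  have h3 : T (fun i => ⌊u n i + y i⌋) x ∈ A := hmem.2
  rwa [hfl] at h3

/-- If the induced action is rigid along `u`, then `u` approaches the integer lattice. -/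
theorem tendsto_sub_round_of_asympInvariant [SigmaFinite μ] {u : ℕ → Fin d → ℝ} {A : Set X}
    (hA0 : μ A ≠ 0) (hAfin : μ A ≠ ⊤)
    (h : ∀ i, AsympInvariant ((cubeMeasure d).prod μ) (fun n => indMap T (u n))
      ({y | y i < 1 / 2} ×ˢ A)) :
    Tendsto (fun n => u n - zcast (roundVec (u n))) atTop (𝓝 0) := by
  refine tendsto_pi_nhds.2 fun i => tendsto_zero_iff_norm_tendsto_zero.2 ?_
  have hlim := ENNReal.Tendsto.const_mul (a := (μ A)⁻¹) (h i)
    (Or.inr (ENNReal.inv_ne_top.2 hA0))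
  rw [mul_zero] at hlim
  have hof : Tendsto (fun n => ENNReal.ofReal |u n i - round (u n i)|) atTop (𝓝 0) := by
    refine tendsto_of_tendsto_of_tendsto_of_le_of_le tendsto_const_nhds hlim
      (fun _ => zero_le) fun n => ?_
    refine (ofReal_abs_sub_round_le_cubeMeasure (u n) i).trans ?_
    rw [← ENNReal.mul_le_iff_le_inv hA0 hAfin, mul_comm, ← Measure.prod_prod]
    refine measure_mono ?_
    rintro ⟨y, x⟩ ⟨⟨hy1, hy2⟩, hx⟩
    refine ⟨⟨hy1, hx⟩, fun hmem => ?_⟩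
    have h3 : Int.fract (u n i + y i) < 1 / 2 := hmem.1
    exact absurd hy2 (not_le.2 h3)
  have := (ENNReal.tendsto_toReal ENNReal.zero_ne_top).comp hof
  simpa [Function.comp_def, ENNReal.toReal_ofReal, roundVec, zcast] using this

theorem IsMPAction.actionRigidAlong_of_rigidAlong [SigmaFinite μ] (hT : IsMPAction μ T)
    {θ : Projectivization ℝ (Fin d → ℝ)} (h : RigidAlong μ T θ) :
    ActionRigidAlong (indMeasure μ) (indMap T) θ := by
  obtain ⟨γ, h1, h2, h3⟩ := h
  rw [θ.submodule_eq] at h2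
  obtain ⟨s, γ', hs, hγ', hlim⟩ := exists_smul_approx h1 h2
  refine ⟨θ.rep, by rw [θ.submodule_eq]; exact Submodule.mem_span_singleton_self _,
    θ.rep_nonzero, s, hs, ?_⟩
  refine (hT.tendsto_inter_indMap_image_iff fun n => s n • θ.rep).2 fun B hB hfin =>
    hT.asympInvariant_indMap (k := fun n => -γ' n) ?_ (fun A hA hAfin => ?_) hB hfin
  · refine hlim.congr fun n => ?_
    rw [zcast_neg]
    abel
  · refine ((hT.tendsto_inter_image_iff γ hA hAfin).1 (h3 A hA hAfin.lt_top)).congr fun n => ?_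
    dsimp only
    rcases hγ' n with h | h
    · rw [h]
    · rw [h, neg_neg, hT.measure_diff_preimage_neg _ hA hAfin]

theorem IsMPAction.rigidAlong_of_actionRigidAlong [SigmaFinite μ] (hT : IsMPAction μ T)
    {θ : Projectivization ℝ (Fin d → ℝ)} (h : ActionRigidAlong (indMeasure μ) (indMap T) θ) :
    RigidAlong μ T θ := by
  obtain ⟨v, hvθ, hv0, s, hs, hrig⟩ := h
  rcases eq_or_ne μ 0 with rfl | hμ
  · obtain ⟨s, γ, hs, hγ⟩ := exists_tendsto_zcast_sub_smul v
    exact ⟨γ, tendsto_norm_zcast hv0 hs hγ, tendsto_infDist_zcast hvθ hγ, by simp⟩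
  have hinv := (hT.tendsto_inter_indMap_image_iff fun n => s n • v).1 hrig
  have hinv' : ∀ (C : Set (Fin d → ℝ)) (A : Set X), MeasurableSet C → MeasurableSet A → μ A ≠ ⊤ →
      AsympInvariant ((cubeMeasure d).prod μ) (fun n => indMap T (-(s n • v))) (C ×ˢ A) :=
    fun C A hC hA hAfin => hinv _ (hC.prod hA) (by
      rw [Measure.prod_prod]
      exact ENNReal.mul_ne_top (measure_ne_top _ _) hAfin)
  obtain ⟨j, hj⟩ : ∃ j, μ (spanningSets μ j) ≠ 0 := by
    by_contra! hall
    refine hμ (Measure.measure_univ_eq_zero.1 ?_)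
    rw [← iUnion_spanningSets μ]
    exact measure_iUnion_null hall
  have hround := tendsto_sub_round_of_asympInvariant hj (measure_spanningSets_lt_top μ j).ne
    fun i => hinv' {y | y i < 1 / 2} _ (measurableSet_lt (measurable_pi_apply i) measurable_const)
      (measurableSet_spanningSets μ j) (measure_spanningSets_lt_top μ j).ne
  set k : ℕ → Fin d → ℤ := fun n => roundVec (-(s n • v))
  have hγ : Tendsto (fun n => zcast (-k n) - s n • v) atTop (𝓝 0) := by
    refine hround.congr fun n => ?_
    rw [zcast_neg]
    abel
  refine ⟨fun n => -k n, tendsto_norm_zcast hv0 hs hγ, tendsto_infDist_zcast hvθ hγ,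
    fun A hA hAfin => (hT.tendsto_inter_image_iff _ hA hAfin.ne).2 ?_⟩
  simp_rw [neg_neg]
  exact asympInvariant_of_indMap hround (hinv' univ A MeasurableSet.univ hA hAfin.ne)

end Action

/-- a line is a rigid direction for a measure preserving `ℤ^d`-action `T` iff it is
a rigid direction for the induced `ℝ^d`-action `T̃` on `[0,1)^d × X`. -/
theorem rigid_directions_eq_induced {X : Type*} [MeasurableSpace X] [StandardBorelSpace X]
    (μ : Measure X) [SigmaFinite μ] {d : ℕ} (hd : 1 ≤ d)
    (T : (Fin d → ℤ) → X ≃ᵐ X) (hT : IsMPAction μ T)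
    (θ : Projectivization ℝ (Fin d → ℝ)) :
    RigidAlong μ T θ ↔ ActionRigidAlong (indMeasure μ) (indMap T) θ := by
  exact ⟨hT.actionRigidAlong_of_rigidAlong, hT.rigidAlong_of_actionRigidAlong⟩
end
end

section
/- Let d ≥ 1 and let T be a measure preserving ℤ^d-action on a σ-finite standard measure space (X, μ). Then the set 𝓡i(T) of rigid directions of T is a G_δ-subset of the projective space P(ℝ^d). -/
open MeasureTheory Filter Set Topology

noncomputable section

/-- The measure of the image of a set under an invertible measure preserving map. -/
lemma measure_image_of_measurePreserving {X : Type*} [MeasurableSpace X] {μ : Measure X}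
    {e : X ≃ᵐ X} (he : MeasurePreserving e μ μ) (s : Set X) : μ (e '' s) = μ s := by
  rw [MeasurableEquiv.image_eq_preimage_symm]
  exact (he.symm e).measure_preimage_equiv s

/-- The lines passing at distance less than `ε` of a given vector form an open set. -/
lemma isOpen_setOf_infDist_lt {d : ℕ} (x : Fin d → ℝ) (ε : ℝ) :
    IsOpen {θ : Projectivization ℝ (Fin d → ℝ) |
      Metric.infDist x (θ.submodule : Set (Fin d → ℝ)) < ε} := by
  refine isOpen_coinduced.2 ?_
  have h : ∀ w : {w : Fin d → ℝ // w ≠ 0},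
      Metric.infDist x ((Projectivization.mk ℝ w.1 w.2).submodule : Set (Fin d → ℝ)) < ε ↔
        ∃ c : ℝ, dist x (c • w.1) < ε := by
    intro w
    rw [Metric.infDist_lt_iff ⟨0, Submodule.zero_mem _⟩, Projectivization.submodule_mk]
    simp [Submodule.mem_span_singleton]
  change IsOpen {w : {w : Fin d → ℝ // w ≠ 0} |
    Metric.infDist x ((Projectivization.mk ℝ w.1 w.2).submodule : Set (Fin d → ℝ)) < ε}
  simp only [h, ofPred_exists]
  exact isOpen_iUnion fun c => isOpen_lt (by fun_prop) continuous_const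

/-- Self-intersections under an invertible measure preserving map vary continuously with
the set. -/
lemma measure_inter_image_le {X : Type*} [MeasurableSpace X] {μ : Measure X}
    {e : X ≃ᵐ X} (he : MeasurePreserving e μ μ) (A B : Set X) :
    μ (B ∩ e '' B) ≤ μ (A ∩ e '' A) + (μ (symmDiff A B) + μ (symmDiff A B)) := by
  calc μ (B ∩ e '' B)
      ≤ μ ((A ∩ e '' A) ∪ (symmDiff A B ∪ e '' symmDiff A B)) := by
        refine measure_mono ?_
        rintro x ⟨hx, y, hy, rfl⟩
        by_cases h1 : e y ∈ A
        · by_cases h2 : y ∈ A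
          · exact Or.inl ⟨h1, y, h2, rfl⟩
          · exact Or.inr (Or.inr ⟨y, Or.inr ⟨hy, h2⟩, rfl⟩)
        · exact Or.inr (Or.inl (Or.inr ⟨hx, h1⟩))
    _ ≤ μ (A ∩ e '' A) + (μ (symmDiff A B) + μ (e '' symmDiff A B)) :=
        (measure_union_le _ _).trans (by gcongr; exact measure_union_le _ _)
    _ = _ := by rw [measure_image_of_measurePreserving he]

/-- A countable family of sets of finite measure, dense in the measure algebra. -/
lemma exists_seq_dense_finite_measure {X : Type*} [MeasurableSpace X] [StandardBorelSpace X]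
    (μ : Measure X) [SigmaFinite μ] :
    ∃ B : ℕ → Set X, (∀ j, MeasurableSet (B j)) ∧ (∀ j, μ (B j) < ⊤) ∧
      ∀ A, MeasurableSet A → μ A < ⊤ → ∀ ε : ℝ, 0 < ε →
        ∃ j, μ (symmDiff A (B j)) < ENNReal.ofReal ε := by
  obtain ⟨𝒜, hc, hd⟩ := exists_countable_measureDense μ
  have hf := hd.fin_meas
  have hc' : {s ∈ 𝒜 | μ s ≠ ⊤}.Countable := hc.mono fun _ h => h.1
  obtain ⟨B, hB⟩ := hc'.exists_eq_range hf.nonempty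
  have hmem : ∀ j, B j ∈ {s ∈ 𝒜 | μ s ≠ ⊤} := fun j => hB ▸ mem_range_self j
  refine ⟨B, fun j => hf.measurable _ (hmem j), fun j => (hmem j).2.lt_top, ?_⟩
  intro A hA hμ ε hε
  obtain ⟨t, ht, h⟩ := hf.approx A hA hμ.ne ε hε
  rw [hB] at ht
  obtain ⟨j, rfl⟩ := ht
  exact ⟨j, h⟩

/-- Rigidity along a sequence of measure preserving maps need only be checked on a dense family
of sets. -/
lemma tendsto_measure_inter_image_of_dense {X : Type*} [MeasurableSpace X] {μ : Measure X}
    {B : ℕ → Set X} (hB : ∀ A, MeasurableSet A → μ A < ⊤ → ∀ ε : ℝ, 0 < ε →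
      ∃ j, μ (symmDiff A (B j)) < ENNReal.ofReal ε)
    {e : ℕ → X ≃ᵐ X} (he : ∀ n, MeasurePreserving (e n) μ μ)
    (h : ∀ n : ℕ, ∀ j ≤ n, μ (B j) ≤ μ (B j ∩ e n '' B j) + ((n : ENNReal) + 1)⁻¹)
    {A : Set X} (hA : MeasurableSet A) (hμ : μ A < ⊤) :
    Tendsto (fun n => μ (A ∩ e n '' A)) atTop (𝓝 (μ A)) := by
  rw [ENNReal.tendsto_nhds hμ.ne]
  intro ε hε
  by_cases hε' : ε = ⊤
  · simp [hε']
  have hpos : 0 < ε.toReal / 4 := by have := ENNReal.toReal_pos hε.ne' hε'; positivity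
  obtain ⟨j, hj⟩ := hB A hA hμ _ hpos
  have hlim : Tendsto (fun n : ℕ => ((n : ENNReal) + 1)⁻¹) atTop (𝓝 0) := by
    have := (tendsto_add_atTop_iff_nat 1).2 ENNReal.tendsto_inv_nat_nhds_zero
    simpa using this
  have hsmall := hlim.eventually_lt_const (ENNReal.ofReal_pos.2 hpos)
  filter_upwards [hsmall, eventually_ge_atTop j] with n hn hjn
  refine ⟨?_, (measure_mono inter_subset_left).trans le_self_add⟩
  rw [tsub_le_iff_right]
  have h1 : μ A ≤ μ (B j) + μ (symmDiff A (B j)) := by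
    refine (measure_mono ?_).trans (measure_union_le _ _)
    intro x hx
    by_cases hxB : x ∈ B j
    · exact Or.inl hxB
    · exact Or.inr (Or.inl ⟨hx, hxB⟩)
  have hsum : ε = ENNReal.ofReal (ε.toReal / 4) + ENNReal.ofReal (ε.toReal / 4) +
      ENNReal.ofReal (ε.toReal / 4) + ENNReal.ofReal (ε.toReal / 4) := by
    rw [← ENNReal.ofReal_add, ← ENNReal.ofReal_add, ← ENNReal.ofReal_add]
    · conv_lhs => rw [← ENNReal.ofReal_toReal hε']
      congr 1
      ring
    all_goals positivity
  calc μ A ≤ μ (B j) + μ (symmDiff A (B j)) := h1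
    _ ≤ (μ (A ∩ e n '' A) + (μ (symmDiff A (B j)) + μ (symmDiff A (B j))) +
          ((n : ENNReal) + 1)⁻¹) + μ (symmDiff A (B j)) := by
        gcongr
        exact (h n j hjn).trans (by gcongr; exact measure_inter_image_le (he n) A (B j))
    _ ≤ (μ (A ∩ e n '' A) + (ENNReal.ofReal (ε.toReal / 4) + ENNReal.ofReal (ε.toReal / 4)) +
          ENNReal.ofReal (ε.toReal / 4)) + ENNReal.ofReal (ε.toReal / 4) := by
        gcongr
    _ = μ (A ∩ e n '' A) + ε := by
        conv_rhs => rw [hsum]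
        ring

/-- the set of rigid directions of a measure preserving `ℤ^d`-action is a
`G_δ`-subset of the projective space `P(ℝ^d)`. -/
theorem rigSet_isGδ {X : Type*} [MeasurableSpace X] [StandardBorelSpace X]
    (μ : Measure X) [SigmaFinite μ] {d : ℕ} (hd : 1 ≤ d)
    (T : (Fin d → ℤ) → X ≃ᵐ X) (hT : IsMPAction μ T) :
    IsGδ (rigSet μ T) := by
  obtain ⟨B, hBm, hBfin, hB⟩ := exists_seq_dense_finite_measure μ
  have key : rigSet μ T = ⋂ n : ℕ, ⋃ γ ∈ {γ : Fin d → ℤ | (n : ℝ) ≤ ‖zcast γ‖ ∧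
      ∀ j ≤ n, μ (B j) ≤ μ (B j ∩ T γ '' B j) + ((n : ENNReal) + 1)⁻¹},
      {θ : Projectivization ℝ (Fin d → ℝ) |
        Metric.infDist (zcast γ) (θ.submodule : Set (Fin d → ℝ)) < ((n : ℝ) + 1)⁻¹} := by
    ext θ
    simp only [mem_iInter, mem_iUnion, exists_prop, mem_ofPred_eq]
    constructor
    · rintro ⟨γ, hnorm, hdist, hrig⟩ n
      have hpos : (0 : ℝ) < ((n : ℝ) + 1)⁻¹ := by positivity
      have hev : ∀ᶠ k in atTop, ∀ j ∈ Iic n,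
          μ (B j) ≤ μ (B j ∩ T (γ k) '' B j) + ((n : ENNReal) + 1)⁻¹ := by
        rw [eventually_all_finite (finite_Iic n)]
        intro j _
        have hlim := (ENNReal.tendsto_nhds (hBfin j).ne).1 (hrig (B j) (hBm j) (hBfin j))
          ((n : ENNReal) + 1)⁻¹ (ENNReal.inv_pos.2 (by finiteness))
        filter_upwards [hlim] with k hk
        exact tsub_le_iff_right.1 hk.1
      obtain ⟨k, h1, h2, h3⟩ := ((hnorm.eventually_ge_atTop (n : ℝ)).and
        ((hdist.eventually_lt_const hpos).and hev)).exists
      exact ⟨γ k, ⟨h1, h3⟩, h2⟩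
    · intro h
      choose γ hγ hdist using h
      refine ⟨γ, tendsto_atTop_mono (fun n => (hγ n).1) tendsto_natCast_atTop_atTop, ?_, ?_⟩
      · refine squeeze_zero (fun n => Metric.infDist_nonneg) (fun n => (hdist n).le) ?_
        simpa using tendsto_one_div_add_atTop_nhds_zero_nat (𝕜 := ℝ)
      · intro A hA hμ
        exact tendsto_measure_inter_image_of_dense hB (fun n => hT.2 (γ n))
          (fun n => (hγ n).2) hA hμ
  rw [key]
  exact .iInter_of_isOpen fun n =>
    isOpen_biUnion fun γ _ => isOpen_setOf_infDist_lt (zcast γ) _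
end
end

section
/- Let d ≥ 1 and let T̂ = (T̂_t)_{t∈ℝ^d} be a measure preserving ℝ^d-action on a σ-finite standard measure space (X, μ) whose restriction T = (T̂_γ)_{γ∈ℤ^d} to ℤ^d is ergodic. Then the set of recurrent directions of T equals the set of recurrent directions of T̂: 𝓡(T) = 𝓡(T̂). -/
open MeasureTheory Filter Set Topology

noncomputable section

section Action

variable {X : Type*} [MeasurableSpace X] {μ : Measure X} {d : ℕ}
  {S : (Fin d → ℝ) → X ≃ᵐ X}

theorem action_zero (hhom : ∀ s t x, S (s + t) x = S s (S t x)) (x : X) : S 0 x = x := by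
  have h := hhom 0 0 x
  rw [add_zero] at h
  exact ((S 0).injective h).symm

theorem action_neg_apply (hhom : ∀ s t x, S (s + t) x = S s (S t x)) (t : Fin d → ℝ) (x : X) :
    S (-t) (S t x) = x := by
  rw [← hhom, neg_add_cancel, action_zero hhom]

theorem action_apply_neg (hhom : ∀ s t x, S (s + t) x = S s (S t x)) (t : Fin d → ℝ) (x : X) :
    S t (S (-t) x) = x := by
  rw [← hhom, add_neg_cancel, action_zero hhom]

theorem image_action_add (hhom : ∀ s t x, S (s + t) x = S s (S t x)) (s t : Fin d → ℝ)
    (A : Set X) : S (s + t) '' A = S s '' (S t '' A) := by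
  rw [image_image]
  exact image_congr fun x _ => hhom s t x

theorem measure_inter_image_action_neg (hhom : ∀ s t x, S (s + t) x = S s (S t x))
    (hmp : ∀ t, MeasurePreserving (S t) μ μ) (t : Fin d → ℝ) (A : Set X) :
    μ (A ∩ S (-t) '' A) = μ (A ∩ S t '' A) := by
  rw [← (hmp t).measure_preimage_equiv (A ∩ S t '' A)]
  congr 1
  ext x
  simp only [mem_inter_iff, mem_preimage, mem_image]
  constructor
  · rintro ⟨hx, y, hy, rfl⟩
    exact ⟨by rwa [action_apply_neg hhom], _, hx, rfl⟩
  · rintro ⟨h, y, hy, hyx⟩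
    obtain rfl := (S t).injective hyx
    exact ⟨hy, _, h, action_neg_apply hhom t y⟩

theorem measurableSet_prod_orbit (hmeas : Measurable fun p : (Fin d → ℝ) × X => S p.1 p.2)
    {B : Set X} (hB : MeasurableSet B) : MeasurableSet {p : X × (Fin d → ℝ) | S p.2 p.1 ∈ B} :=
  (hmeas.comp measurable_swap) hB

theorem measurable_volume_return (hmeas : Measurable fun p : (Fin d → ℝ) × X => S p.1 p.2)
    {B : Set X} (hB : MeasurableSet B) (r : ℝ) :
    Measurable fun x => volume ({u | S u x ∈ B} ∩ Metric.closedBall (0 : Fin d → ℝ) r) := by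
  have h : MeasurableSet {p : X × (Fin d → ℝ) | S p.2 p.1 ∈ B ∧
      p.2 ∈ Metric.closedBall (0 : Fin d → ℝ) r} :=
    (measurableSet_prod_orbit hmeas hB).inter (measurable_snd measurableSet_closedBall)
  exact measurable_measure_prodMk_left h

/-- Almost every point of `B` has an orbit spending most of a small ball of times in `B`. -/
theorem ae_exists_lt_volume_return [SigmaFinite μ]
    (hhom : ∀ s t x, S (s + t) x = S s (S t x))
    (hmp : ∀ t, MeasurePreserving (S t) μ μ)
    (hmeas : Measurable fun p : (Fin d → ℝ) × X => S p.1 p.2)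
    {B : Set X} (hB : MeasurableSet B) {c : ENNReal} (hc : c < 1) :
    ∀ᵐ x ∂μ, x ∈ B → ∃ n : ℕ, c * volume (Metric.closedBall (0 : Fin d → ℝ) (1 / (n + 1 : ℝ))) <
      volume ({u | S u x ∈ B} ∩ Metric.closedBall (0 : Fin d → ℝ) (1 / (n + 1 : ℝ))) := by
  have hmeasG : ∀ n : ℕ, Measurable fun x => volume
      ({u | S u x ∈ B} ∩ Metric.closedBall (0 : Fin d → ℝ) (1 / (n + 1 : ℝ))) := fun n =>
    measurable_volume_return hmeas hB _
  set P : Set X := {x | x ∈ B → ∃ n : ℕ,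
    c * volume (Metric.closedBall (0 : Fin d → ℝ) (1 / (n + 1 : ℝ))) <
      volume ({u | S u x ∈ B} ∩ Metric.closedBall (0 : Fin d → ℝ) (1 / (n + 1 : ℝ)))} with hP
  have hPm : MeasurableSet P := by
    have : P = Bᶜ ∪ ⋃ n : ℕ, {x | c * volume (Metric.closedBall (0 : Fin d → ℝ) (1 / (n + 1 : ℝ))) <
      volume ({u | S u x ∈ B} ∩ Metric.closedBall (0 : Fin d → ℝ) (1 / (n + 1 : ℝ)))} := by
      ext x
      simp only [hP, mem_ofPred_eq, mem_union, mem_compl_iff, mem_iUnion]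
      tauto
    rw [this]
    exact hB.compl.union (.iUnion fun n => measurableSet_lt measurable_const (hmeasG n))
  have h1 : ∀ x, ∀ᵐ u : Fin d → ℝ, S u x ∈ P := by
    intro x
    have hE : MeasurableSet {u | S u x ∈ B} :=
      (hmeas.comp (measurable_id.prodMk measurable_const)) hB
    filter_upwards [Besicovitch.ae_tendsto_measure_inter_div_of_measurableSet volume hE]
      with u hu huB
    rw [indicator_of_mem (by exact huB)] at hu
    have hseq : Tendsto (fun n : ℕ => 1 / (n + 1 : ℝ)) atTop (𝓝[>] 0) :=
      tendsto_nhdsWithin_iff.2 ⟨tendsto_one_div_add_atTop_nhds_zero_nat,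
        .of_forall fun n => by simp only [mem_Ioi]; positivity⟩
    obtain ⟨n, hn⟩ := ((hu.comp hseq).eventually (lt_mem_nhds hc)).exists
    refine ⟨n, ?_⟩
    simp only [Function.comp_apply] at hn
    have hpre := measure_preimage_add_right (volume : Measure (Fin d → ℝ)) u
      ({u | S u x ∈ B} ∩ Metric.closedBall u (1 / (n + 1 : ℝ)))
    have hset : (fun h => h + u) ⁻¹' ({u | S u x ∈ B} ∩ Metric.closedBall u (1 / (n + 1 : ℝ))) =
        {w | S w (S u x) ∈ B} ∩ Metric.closedBall 0 (1 / (n + 1 : ℝ)) := by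
      ext w
      simp [hhom, dist_eq_norm]
    have hball : volume (Metric.closedBall u (1 / (n + 1 : ℝ))) =
        volume (Metric.closedBall (0 : Fin d → ℝ) (1 / (n + 1 : ℝ))) :=
      Measure.addHaar_closedBall_center volume u _
    rw [← hset, hpre, ← hball]
    exact ENNReal.mul_lt_of_lt_div hn
  have h2 : ∀ᵐ u : Fin d → ℝ, ∀ᵐ x ∂μ, S u x ∈ P :=
    (Measure.ae_ae_comm (measurableSet_prod_orbit hmeas hPm)).1 (ae_of_all _ h1)
  obtain ⟨u, hu⟩ := h2.exists
  filter_upwards [(hmp (-u)).quasiMeasurePreserving.ae hu] with x hx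
  rwa [action_apply_neg hhom] at hx

theorem exists_volume_closedBall_add_lt (d : ℕ) {r : ℝ} (hr : 0 < r) :
    ∃ ε : ℝ, 0 < ε ∧ volume (Metric.closedBall (0 : Fin d → ℝ) (r + ε)) <
      3 / 4 * volume (Metric.closedBall (0 : Fin d → ℝ) r) +
      3 / 4 * volume (Metric.closedBall (0 : Fin d → ℝ) r) := by
  have hcont : Tendsto (fun ε : ℝ => (2 * (r + ε)) ^ d) (𝓝[>] 0) (𝓝 ((2 * (r + 0)) ^ d)) :=
    (Continuous.tendsto (by fun_prop) 0).mono_left nhdsWithin_le_nhds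
  have hpos : 0 < (2 * r) ^ d := by positivity
  obtain ⟨ε, hε, h0⟩ := ((hcont.eventually_lt_const (u := 3 / 2 * (2 * r) ^ d)
    (by rw [add_zero]; linarith)).and self_mem_nhdsWithin).exists
  have h0 : 0 < ε := h0
  refine ⟨ε, h0, ?_⟩
  rw [Real.volume_pi_closedBall _ hr.le, Real.volume_pi_closedBall _ (by positivity),
    Fintype.card_fin]
  have h34 : (3 / 4 : ENNReal) = ENNReal.ofReal (3 / 4) := by
    rw [ENNReal.ofReal_div_of_pos (by norm_num)]; simp
  rw [h34, ← ENNReal.ofReal_mul (by norm_num), ← ENNReal.ofReal_add (by positivity) (by positivity),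
    ENNReal.ofReal_lt_ofReal_iff (by positivity)]
  linarith

/-- Returns at time `t` of a suitable set `A` force returns of `B` at all times near `t`. -/
theorem exists_return_stable_set [SigmaFinite μ]
    (hhom : ∀ s t x, S (s + t) x = S s (S t x))
    (hmp : ∀ t, MeasurePreserving (S t) μ μ)
    (hmeas : Measurable fun p : (Fin d → ℝ) × X => S p.1 p.2)
    {B : Set X} (hB : MeasurableSet B) (hB0 : 0 < μ B) :
    ∃ A : Set X, MeasurableSet A ∧ 0 < μ A ∧ ∃ ε : ℝ, 0 < ε ∧ ∀ t t' : Fin d → ℝ,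
      ‖t - t'‖ < ε → 0 < μ (A ∩ S t '' A) → 0 < μ (B ∩ S t' '' B) := by
  have hc : (3 / 4 : ENNReal) < 1 := ENNReal.div_lt_of_lt_mul (by norm_num)
  have hae := ae_exists_lt_volume_return hhom hmp hmeas hB hc
  set A : ℕ → Set X := fun n =>
    {x | 3 / 4 * volume (Metric.closedBall (0 : Fin d → ℝ) (1 / (n + 1 : ℝ))) <
      volume ({u | S u x ∈ B} ∩ Metric.closedBall (0 : Fin d → ℝ) (1 / (n + 1 : ℝ)))} with hA
  have hAm : ∀ n, MeasurableSet (A n) := fun n =>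
    measurableSet_lt measurable_const (measurable_volume_return hmeas hB _)
  obtain ⟨n, hn⟩ : ∃ n, 0 < μ (A n) := by
    by_contra! hcon
    have h0 : μ (⋃ n, A n) = 0 := measure_iUnion_null fun n => le_antisymm (hcon n) (zero_le)
    refine hB0.ne' (measure_mono_null_ae ?_ h0)
    filter_upwards [hae] with x hx hxB
    exact mem_iUnion.2 (hx hxB)
  obtain ⟨ε, hε, hvol⟩ := exists_volume_closedBall_add_lt d (r := 1 / (n + 1 : ℝ)) (by positivity)
  refine ⟨A n, hAm n, hn, ε, hε, fun t t' htt hpos => ?_⟩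
  rw [pos_iff_ne_zero]
  intro hnull
  have hCm : MeasurableSet (B ∩ S t' '' B) := hB.inter ((S t').measurableSet_image.2 hB)
  have h1 : ∀ᵐ x ∂μ, ∀ᵐ u : Fin d → ℝ, S u x ∈ (B ∩ S t' '' B)ᶜ := by
    rw [Measure.ae_ae_comm (measurableSet_prod_orbit hmeas hCm.compl)]
    exact ae_of_all _ fun u =>
      (hmp u).quasiMeasurePreserving.ae (p := fun y => y ∈ (B ∩ S t' '' B)ᶜ)
        (measure_eq_zero_iff_ae_notMem.1 hnull)
  obtain ⟨x, ⟨hxA, y, hyA, hyx⟩, hx⟩ :=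
    ((frequently_ae_mem_iff.2 hpos.ne').and_eventually h1).exists
  set r : ℝ := 1 / (n + 1 : ℝ) with hr
  set U := {u | S u x ∈ B} ∩ Metric.closedBall (0 : Fin d → ℝ) r with hU
  set V := {u | S u y ∈ B} ∩ Metric.closedBall (0 : Fin d → ℝ) r with hV
  have hVm : MeasurableSet V :=
    ((hmeas.comp (measurable_id.prodMk measurable_const)) hB).inter
      Metric.isClosed_closedBall.measurableSet
  set V' := (fun h => h + (t - t')) ⁻¹' V with hV'
  have hVV : volume V' = volume V := measure_preimage_add_right _ _ _
  have hV'm : MeasurableSet V' := (measurable_add_const _) hVm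
  have hdisj : volume (U ∩ V') = 0 := by
    refine measure_mono_null (fun u hu => ?_) hx
    simp only [mem_ofPred_eq, not_not, mem_compl_iff]
    refine ⟨hu.1.1, S (u + (t - t')) y, hu.2.1, ?_⟩
    rw [← hyx, ← hhom, ← hhom, show t' + (u + (t - t')) = u + t by abel]
  have hsub : U ∪ V' ⊆ Metric.closedBall (0 : Fin d → ℝ) (r + ε) := by
    rintro u (hu | hu)
    · exact Metric.closedBall_subset_closedBall (by linarith) hu.2
    · have h3 := hu.2
      simp only [Metric.mem_closedBall, dist_zero_right] at h3 ⊢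
      calc ‖u‖ = ‖u + (t - t') - (t - t')‖ := by congr 1; abel
        _ ≤ _ := (norm_sub_le _ _).trans (by linarith)
  have hsum : volume (U ∪ V') = volume U + volume V := by
    rw [← hVV, ← measure_union_add_inter U hV'm, hdisj, add_zero]
  have hxA : 3 / 4 * volume (Metric.closedBall (0 : Fin d → ℝ) r) < volume U := hxA
  have hyA : 3 / 4 * volume (Metric.closedBall (0 : Fin d → ℝ) r) < volume V := hyA
  exact absurd ((ENNReal.add_lt_add hxA hyA).trans_le (hsum ▸ measure_mono hsub)) hvol.not_gt

theorem one_le_norm_zcast {γ : Fin d → ℤ} (hγ : γ ≠ 0) : 1 ≤ ‖zcast γ‖ := by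
  obtain ⟨i, hi⟩ := Function.ne_iff.1 hγ
  refine le_trans ?_ (norm_le_pi_norm (zcast γ) i)
  rw [zcast, Real.norm_eq_abs, ← Int.cast_abs]
  exact_mod_cast Int.one_le_abs hi

theorem finite_setOf_norm_zcast_le (N : ℝ) : {γ : Fin d → ℤ | ‖zcast γ‖ ≤ N}.Finite := by
  refine (Set.finite_Icc (fun _ => -⌈N⌉) (fun _ => ⌈N⌉)).subset fun γ hγ => ?_
  have h : ∀ i, |γ i| ≤ ⌈N⌉ := fun i => by
    have h1 := ((norm_le_pi_norm (zcast γ) i).trans hγ).trans (Int.le_ceil N)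
    rw [zcast, Real.norm_eq_abs, ← Int.cast_abs] at h1
    exact_mod_cast h1
  exact ⟨fun i => (abs_le.1 (h i)).1, fun i => (abs_le.1 (h i)).2⟩

/-- Integer vectors of bounded norm that are close enough to a line lie on it. -/
theorem exists_pos_forall_zcast_mem (W : Submodule ℝ (Fin d → ℝ)) (N : ℝ) :
    ∃ δ : ℝ, 0 < δ ∧ ∀ γ : Fin d → ℤ, ‖zcast γ‖ ≤ N → ∀ w ∈ W, ‖zcast γ - w‖ < δ →
      zcast γ ∈ W := by
  have h : ∀ γ ∈ {γ : Fin d → ℤ | ‖zcast γ‖ ≤ N}, ∀ᶠ δ : ℝ in 𝓝[>] 0,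
      ∀ w ∈ W, ‖zcast γ - w‖ < δ → zcast γ ∈ W := by
    intro γ _
    by_cases hγ : zcast γ ∈ W
    · exact .of_forall fun _ _ _ _ => hγ
    · have hcl : IsClosed (W : Set (Fin d → ℝ)) := W.closed_of_finiteDimensional
      obtain ⟨δ, hδ, hball⟩ := Metric.isOpen_iff.1 hcl.isOpen_compl (zcast γ) hγ
      filter_upwards [Ioo_mem_nhdsGT hδ] with δ' hδ' w hw hdist
      refine absurd hw (hball ?_)
      rw [Metric.mem_ball, dist_comm, dist_eq_norm]
      exact hdist.trans hδ'.2
  obtain ⟨δ, h1, h2⟩ := (((finite_setOf_norm_zcast_le N).eventually_all.2 h).and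
    self_mem_nhdsWithin).exists
  exact ⟨δ, h2, h1⟩

/-- Recurrence along a line produces arbitrarily long return vectors near that line. -/
theorem RecurrentAlong.exists_norm_gt (hhom : ∀ s t x, S (s + t) x = S s (S t x))
    (hmp : ∀ t, MeasurePreserving (S t) μ μ) {θ : Projectivization ℝ (Fin d → ℝ)}
    (hrec : RecurrentAlong μ (fun γ => S (zcast γ)) θ) {ε : ℝ} (hε : 0 < ε) (N : ℝ)
    {A : Set X} (hA : MeasurableSet A) (hA0 : 0 < μ A) :
    ∃ γ : Fin d → ℤ, N < ‖zcast γ‖ ∧ ∃ w ∈ θ.submodule, ‖zcast γ - w‖ < ε ∧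
      0 < μ (A ∩ S (zcast γ) '' A) := by
  by_contra! hcon
  set v := θ.rep
  have hv0 : v ≠ 0 := θ.rep_nonzero
  have hvpos : 0 < ‖v‖ := norm_pos_iff.2 hv0
  have hθ : θ.submodule = Submodule.span ℝ {v} := θ.submodule_eq
  obtain ⟨δ, hδ, hmem⟩ := exists_pos_forall_zcast_mem θ.submodule N
  have step : ∀ A' ⊆ A, MeasurableSet A' → 0 < μ A' → ∃ γ : Fin d → ℤ, ∃ c : ℝ,
      zcast γ = c • v ∧ 1 / ‖v‖ ≤ c ∧ 0 < μ (A' ∩ S (zcast γ) '' A') := by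
    intro A' hsub hA'm hA'0
    obtain ⟨γ, hγ0, w, hw, hdist, hpos⟩ := hrec (min ε δ) (lt_min hε hδ) A' hA'm hA'0
    have hle : ‖zcast γ‖ ≤ N := by
      by_contra! hlt
      refine (hpos.trans_le (measure_mono ?_)).ne'
        (le_antisymm (hcon γ hlt w hw (hdist.trans_le (min_le_left _ _))) zero_le)
      exact inter_subset_inter hsub (image_mono hsub)
    have hγθ := hmem γ hle w hw (hdist.trans_le (min_le_right _ _))
    rw [hθ, Submodule.mem_span_singleton] at hγθ
    obtain ⟨c, hc⟩ := hγθ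
    have hone := one_le_norm_zcast hγ0
    rw [← hc, norm_smul, Real.norm_eq_abs] at hone
    have habs : 1 / ‖v‖ ≤ |c| := by rwa [div_le_iff₀ hvpos]
    rcases le_total 0 c with h0 | h0
    · exact ⟨γ, c, hc.symm, by rwa [abs_of_nonneg h0] at habs, hpos⟩
    · have hneg : zcast (-γ) = -zcast γ := by
        ext i
        simp [zcast]
      refine ⟨-γ, -c, by rw [hneg, ← hc, neg_smul], by rwa [abs_of_nonpos h0] at habs, ?_⟩
      rw [hneg, measure_inter_image_action_neg hhom hmp]
      exact hpos
  have iter : ∀ n : ℕ, ∃ A' ⊆ A, MeasurableSet A' ∧ 0 < μ A' ∧ ∃ γ : Fin d → ℤ, ∃ c : ℝ,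
      zcast γ = c • v ∧ n * (1 / ‖v‖) ≤ c ∧ A' ⊆ S (zcast γ) '' A := by
    intro n
    induction n with
    | zero =>
      have h0 : zcast (0 : Fin d → ℤ) = 0 := by
        ext i
        simp [zcast]
      refine ⟨A, subset_rfl, hA, hA0, 0, 0, by rw [h0, zero_smul], by simp, fun x hx => ?_⟩
      exact ⟨x, hx, by rw [h0, action_zero hhom]⟩
    | succ n ih =>
      obtain ⟨A', hsub, hA'm, hA'0, γ, c, hc, hn, hA'⟩ := ih
      obtain ⟨γ₁, c₁, hc₁, hn₁, hpos⟩ := step A' hsub hA'm hA'0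
      have hadd : zcast (γ₁ + γ) = zcast γ₁ + zcast γ := by
        ext i
        simp [zcast]
      refine ⟨_, inter_subset_left.trans hsub,
        hA'm.inter ((S (zcast γ₁)).measurableSet_image.2 hA'm), hpos, γ₁ + γ, c₁ + c,
        by rw [hadd, hc, hc₁, add_smul], by push_cast; linarith, ?_⟩
      rw [hadd, image_action_add hhom]
      exact inter_subset_right.trans (image_mono hA')
  obtain ⟨n, hn⟩ := exists_nat_gt N
  obtain ⟨A', hsub, -, hA'0, γ, c, hc, hnc, hA'⟩ := iter n
  have hc0 : 0 ≤ c := le_trans (by positivity) hnc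
  have hNγ : N < ‖zcast γ‖ := by
    rw [hc, norm_smul, Real.norm_of_nonneg hc0]
    rw [mul_one_div, div_le_iff₀ hvpos] at hnc
    exact hn.trans_le hnc
  have hγθ : zcast γ ∈ θ.submodule := by
    rw [hθ, hc]
    exact Submodule.smul_mem _ _ (Submodule.mem_span_singleton_self v)
  exact (hA'0.trans_le (measure_mono (subset_inter hsub hA'))).ne'
    (le_antisymm (hcon γ hNγ _ hγθ (by simpa using hε)) zero_le)

/-- A conservative flow has return times whose displacement is close to the integer lattice. -/
theorem FlowConservative.exists_near_zcast (hhom : ∀ s t x, S (s + t) x = S s (S t x))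
    {v : Fin d → ℝ} (hcons : FlowConservative μ (fun s => ⇑(S (s • v)))) {ε : ℝ} (hε : 0 < ε)
    (M : ℝ) {A : Set X} (hA : MeasurableSet A) (hA0 : 0 < μ A) :
    ∃ s : ℝ, M < |s| ∧ ∃ γ : Fin d → ℤ, ‖zcast γ - s • v‖ < ε ∧
      0 < μ (A ∩ S (s • v) '' A) := by
  have step : ∀ p : {A : Set X // MeasurableSet A ∧ 0 < μ A}, ∀ L : ℝ, ∃ s : ℝ, L < |s| ∧
      0 < μ (p.1 ∩ S (s • v) '' p.1) := by
    intro p L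
    obtain ⟨s, hs, hpos⟩ := hcons p.1 p.2.1 p.2.2 (Set.Icc (-L) L) isCompact_Icc
    refine ⟨s, ?_, hpos⟩
    by_contra! hle
    exact hs (abs_le.1 hle)
  choose τ hτ hτpos using step
  -- The states are (current set, partial sum of times, bound for all partial sums so far).
  let next : {A : Set X // MeasurableSet A ∧ 0 < μ A} × ℝ × ℝ →
      {A : Set X // MeasurableSet A ∧ 0 < μ A} × ℝ × ℝ := fun q =>
    (⟨q.1.1 ∩ S (τ q.1 (M + 2 * q.2.2) • v) '' q.1.1,
      q.1.2.1.inter ((S _).measurableSet_image.2 q.1.2.1), hτpos _ _⟩,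
      τ q.1 (M + 2 * q.2.2) + q.2.1, |τ q.1 (M + 2 * q.2.2)| + q.2.2)
  let st : ℕ → {A : Set X // MeasurableSet A ∧ 0 < μ A} × ℝ × ℝ := fun n =>
    next^[n] (⟨A, hA, hA0⟩, 0, 0)
  have hst : ∀ n, st (n + 1) = next (st n) := fun n => Function.iterate_succ_apply' _ _ _
  set B : ℕ → Set X := fun n => (st n).1.1 with hB
  set σ : ℕ → ℝ := fun n => (st n).2.1 with hσ
  set L : ℕ → ℝ := fun n => (st n).2.2 with hL
  set t : ℕ → ℝ := fun n => τ (st n).1 (M + 2 * L n) with ht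
  have hBs : ∀ n, B (n + 1) = B n ∩ S (t n • v) '' B n := fun n => by simp only [hB, hst]; rfl
  have hσs : ∀ n, σ (n + 1) = t n + σ n := fun n => by simp only [hσ, hst]; rfl
  have hLs : ∀ n, L (n + 1) = |t n| + L n := fun n => by simp only [hL, hst]; rfl
  have htL : ∀ n, M + 2 * L n < |t n| := fun n => hτ _ _
  have hanti : Antitone B := antitone_nat_of_succ_le fun n => by
    rw [hBs]
    exact inter_subset_left
  have hBA : ∀ n, B n ⊆ A := fun n => hanti (Nat.zero_le n)
  have hbound : ∀ n, ∀ k ≤ n, |σ k| ≤ L n := by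
    intro n
    induction n with
    | zero =>
      intro k hk
      obtain rfl := Nat.le_zero.1 hk
      simp [hσ, hL, st]
    | succ n ih =>
      intro k hk
      rw [hLs]
      rcases hk.lt_or_eq with h | rfl
      · exact (ih k (Nat.lt_succ_iff.1 h)).trans (le_add_of_nonneg_left (abs_nonneg _))
      · rw [hσs]
        exact (abs_add_le _ _).trans (add_le_add_right (ih n le_rfl) _)
  have hfar : ∀ i j, i < j → M < |σ j - σ i| := by
    intro i j hij
    obtain ⟨k, rfl⟩ := Nat.exists_eq_succ_of_ne_zero (Nat.ne_zero_of_lt hij)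
    have h1 := hbound k i (Nat.lt_succ_iff.1 hij)
    have h2 := hbound k k le_rfl
    have h3 := htL k
    have h4 : t k = (σ (k + 1) - σ i) + (σ i - σ k) := by rw [hσs]; ring
    have h5 := abs_add_le (σ (k + 1) - σ i) (σ i - σ k)
    have h6 := abs_sub (σ i) (σ k)
    rw [← h4] at h5
    change M < |σ (k + 1) - σ i|
    linarith
  have hret : ∀ i j, i ≤ j → B j ⊆ S ((σ j - σ i) • v) '' B i := by
    intro i j hij
    induction j, hij using Nat.le_induction with
    | base =>
      intro x hx
      exact ⟨x, hx, by rw [sub_self, zero_smul, action_zero hhom]⟩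
    | succ j hij ih =>
      rw [hBs, hσs, add_sub_assoc, add_smul, image_action_add hhom]
      exact inter_subset_right.trans (image_mono ih)
  let x : ℕ → Fin d → ℝ := fun n i => Int.fract (σ n * v i)
  have hx : ∀ n, x n ∈ Set.Icc (0 : Fin d → ℝ) 1 := fun n =>
    ⟨fun i => Int.fract_nonneg _, fun i => (Int.fract_lt_one _).le⟩
  obtain ⟨a, -, φ, hφ, hlim⟩ := (isCompact_Icc (a := (0 : Fin d → ℝ)) (b := 1)).tendsto_subseq hx
  obtain ⟨n, hn⟩ := Metric.cauchySeq_iff'.1 hlim.cauchySeq ε hε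
  have hij : φ n < φ (n + 1) := hφ n.lt_succ_self
  refine ⟨σ (φ (n + 1)) - σ (φ n), hfar _ _ hij,
    fun i => ⌊σ (φ (n + 1)) * v i⌋ - ⌊σ (φ n) * v i⌋, ?_, ?_⟩
  · have h := hn (n + 1) n.le_succ
    rw [dist_comm, dist_eq_norm] at h
    refine lt_of_eq_of_lt (congrArg norm (funext fun i => ?_)) h
    simp only [zcast, x, Function.comp_apply, Pi.sub_apply, Pi.smul_apply, smul_eq_mul,
      Int.fract, Int.cast_sub]
    ring
  · exact (st (φ (n + 1))).1.2.2.trans_le (measure_mono (subset_inter (hBA _)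
      ((hret _ _ hij.le).trans (image_mono (hBA _)))))

theorem RecurrentAlong.actionRecurrentAlong [SigmaFinite μ]
    (hhom : ∀ s t x, S (s + t) x = S s (S t x)) (hmp : ∀ t, MeasurePreserving (S t) μ μ)
    (hmeas : Measurable fun p : (Fin d → ℝ) × X => S p.1 p.2)
    {θ : Projectivization ℝ (Fin d → ℝ)}
    (hrec : RecurrentAlong μ (fun γ => S (zcast γ)) θ) :
    ActionRecurrentAlong μ (fun t => ⇑(S t)) θ := by
  have hθ : θ.submodule = Submodule.span ℝ {θ.rep} := θ.submodule_eq
  refine ⟨θ.rep, by rw [hθ]; exact Submodule.mem_span_singleton_self _, θ.rep_nonzero, ?_⟩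
  intro B hB hB0 K hK
  obtain ⟨M, hM⟩ := hK.isBounded.exists_norm_le
  obtain ⟨A, hA, hA0, ε, hε, hstable⟩ := exists_return_stable_set hhom hmp hmeas hB hB0
  obtain ⟨γ, hγ, w, hw, hdist, hpos⟩ :=
    hrec.exists_norm_gt hhom hmp hε (M * ‖θ.rep‖ + ε) hA hA0
  rw [hθ, Submodule.mem_span_singleton] at hw
  obtain ⟨s, rfl⟩ := hw
  refine ⟨s, fun hs => ?_, hstable _ _ hdist hpos⟩
  have h1 := mul_le_mul_of_nonneg_right (hM s hs) (norm_nonneg θ.rep)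
  rw [← norm_smul] at h1
  have h2 := norm_sub_norm_le (zcast γ) (s • θ.rep)
  linarith

theorem ActionRecurrentAlong.recurrentAlong [SigmaFinite μ]
    (hhom : ∀ s t x, S (s + t) x = S s (S t x)) (hmp : ∀ t, MeasurePreserving (S t) μ μ)
    (hmeas : Measurable fun p : (Fin d → ℝ) × X => S p.1 p.2)
    {θ : Projectivization ℝ (Fin d → ℝ)}
    (hrec : ActionRecurrentAlong μ (fun t => ⇑(S t)) θ) :
    RecurrentAlong μ (fun γ => S (zcast γ)) θ := by
  obtain ⟨v, hv, hv0, hcons⟩ := hrec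
  intro ε hε B hB hB0
  obtain ⟨A, hA, hA0, δ, hδ, hstable⟩ := exists_return_stable_set hhom hmp hmeas hB hB0
  obtain ⟨s, hs, γ, hdist, hpos⟩ :=
    hcons.exists_near_zcast hhom (lt_min hε hδ) (ε / ‖v‖) hA hA0
  have hdist_ε := hdist.trans_le (min_le_left _ _)
  refine ⟨γ, ?_, s • v, Submodule.smul_mem _ _ hv, hdist_ε, hstable (s • v) _ ?_ hpos⟩
  · rintro rfl
    have h0 : zcast (0 : Fin d → ℤ) = 0 := by
      ext i
      simp [zcast]
    rw [h0, zero_sub, norm_neg, norm_smul, Real.norm_eq_abs] at hdist_ε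
    rw [div_lt_iff₀ (norm_pos_iff.2 hv0)] at hs
    linarith
  · rw [norm_sub_rev]
    exact hdist.trans_le (min_le_right _ _)

end Action

/-- if a measure preserving `ℝ^d`-action `T̂` restricts to an ergodic `ℤ^d`-action
`T`, then the recurrent directions of `T` coincide with the recurrent directions of `T̂`. -/
theorem recSet_restriction_eq {X : Type*} [MeasurableSpace X] [StandardBorelSpace X]
    (μ : Measure X) [SigmaFinite μ] {d : ℕ} (hd : 1 ≤ d)
    (That : (Fin d → ℝ) → X ≃ᵐ X)
    (hhom : ∀ s t : Fin d → ℝ, ∀ x : X, That (s + t) x = That s (That t x))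
    (hmp : ∀ t : Fin d → ℝ, MeasurePreserving (That t) μ μ)
    (hmeas : Measurable fun p : (Fin d → ℝ) × X => That p.1 p.2)
    (herg : ∀ A : Set X, MeasurableSet A →
      (∀ γ : Fin d → ℤ, That (zcast γ) '' A = A) → μ A = 0 ∨ μ Aᶜ = 0) :
    recSet μ (fun γ => That (zcast γ)) =
      {θ | ActionRecurrentAlong μ (fun t => ⇑(That t)) θ} := by
  ext θ
  exact ⟨fun h => h.actionRecurrentAlong hhom hmp hmeas,
    fun h => h.recurrentAlong hhom hmp hmeas⟩
end
end

section
/- Let F = (F_t)_{t∈ℝ} be a measure preserving flow on a σ-finite standard measure space (Y, ν) and let S = (S_t)_{t∈ℝ} be a measure preserving flow on a standard probability space (Z, κ). Then F is conservative if and only if the product flow (F_t × S_t)_{t∈ℝ} on (Y × Z, ν × κ) is conservative. -/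
open MeasureTheory Filter Set Topology

noncomputable section

/-- Translating a tail integral over a half-line. -/
lemma setLIntegral_Ioi_comp_add_right (g : ℝ → ENNReal) (a s : ℝ) :
    ∫⁻ t in Ioi a, g (t + s) = ∫⁻ t in Ioi (a + s), g t := by
  have h := (measurePreserving_add_right (volume : Measure ℝ) s).setLIntegral_comp_preimage_emb
    (measurableEmbedding_addRight s) g (Ioi (a + s))
  rw [← h]
  congr 2
  ext t
  simp

/-- The tails of a convergent integral are eventually small. -/
lemma exists_nat_setLIntegral_Ioi_lt {g : ℝ → ENNReal}
    (hfin : ∫⁻ t in Ioi (0 : ℝ), g t ≠ ⊤) {δ : ENNReal} (hδ : 0 < δ) :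
    ∃ N : ℕ, ∫⁻ t in Ioi (N : ℝ), g t < δ := by
  have hlim : Tendsto (fun N : ℕ => volume.withDensity g (Ioi (N : ℝ))) atTop
      (𝓝 (volume.withDensity g (⋂ N : ℕ, Ioi (N : ℝ)))) := by
    refine tendsto_measure_iInter_atTop (fun _ => measurableSet_Ioi.nullMeasurableSet)
      (fun m n hmn => Ioi_subset_Ioi (by exact_mod_cast hmn)) ⟨0, ?_⟩
    rw [withDensity_apply _ measurableSet_Ioi]
    simpa using hfin
  have hempty : (⋂ N : ℕ, Ioi (N : ℝ)) = ∅ := by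
    ext x
    obtain ⟨n, hn⟩ := exists_nat_ge x
    simpa using ⟨n, hn⟩
  rw [hempty, measure_empty] at hlim
  obtain ⟨N, hN⟩ := (hlim.eventually_lt_const hδ).exists
  exact ⟨N, by rwa [withDensity_apply _ measurableSet_Ioi] at hN⟩

section Flow

variable {X : Type*} [MeasurableSpace X] {G : ℝ → X ≃ᵐ X}

lemma flow_zero_apply (hG : ∀ s t x, G (s + t) x = G s (G t x)) (x : X) : G 0 x = x :=
  (G 0).injective (by rw [← hG, add_zero])

lemma flow_neg_apply_apply (hG : ∀ s t x, G (s + t) x = G s (G t x)) (s : ℝ) (x : X) :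
    G (-s) (G s x) = x := by
  rw [← hG, neg_add_cancel, flow_zero_apply hG]

lemma flow_image_neg_eq_preimage (hG : ∀ s t x, G (s + t) x = G s (G t x)) (s : ℝ) (A : Set X) :
    G (-s) '' A = G s ⁻¹' A := by
  ext x
  constructor
  · rintro ⟨y, hy, rfl⟩
    have h := flow_neg_apply_apply hG (-s) y
    rw [neg_neg] at h
    rwa [mem_preimage, h]
  · exact fun hx => ⟨G s x, hx, flow_neg_apply_apply hG s x⟩

/-- The integral of a function along the positive half-orbit of a point. -/
def forwardIntegral (G : ℝ → X ≃ᵐ X) (φ : X → ENNReal) (x : X) : ENNReal :=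
  ∫⁻ t in Ioi (0 : ℝ), φ (G t x)

lemma forwardIntegral_flow (hG : ∀ s t x, G (s + t) x = G s (G t x)) (φ : X → ENNReal)
    (s : ℝ) (x : X) : forwardIntegral G φ (G s x) = ∫⁻ t in Ioi s, φ (G t x) := by
  have h := setLIntegral_Ioi_comp_add_right (fun t => φ (G t x)) 0 s
  rw [zero_add] at h
  simp only [forwardIntegral, ← hG, h]

lemma measurable_forwardIntegral (hGm : Measurable fun p : ℝ × X => G p.1 p.2) {φ : X → ENNReal}
    (hφ : Measurable φ) : Measurable (forwardIntegral G φ) :=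
  (hφ.comp hGm).lintegral_prod_left'

/-- For a conservative flow, finite forward orbital integrals vanish. -/
lemma FlowConservative.forwardIntegral_ae_eq_zero {μ : Measure X}
    (hcons : FlowConservative μ (fun t => ⇑(G t)))
    (hG : ∀ s t x, G (s + t) x = G s (G t x))
    (hGm : Measurable fun p : ℝ × X => G p.1 p.2) {φ : X → ENNReal} (hφ : Measurable φ)
    (hfin : ∀ x, forwardIntegral G φ x ≠ ⊤) : forwardIntegral G φ =ᵐ[μ] 0 := by
  set u := forwardIntegral G φ
  have hu : Measurable u := measurable_forwardIntegral hGm hφ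
  have hnull : ∀ k N : ℕ, μ {x | ((k : ENNReal) + 1)⁻¹ ≤ u x ∧ u (G N x) < ((k : ENNReal) + 1)⁻¹}
      = 0 := by
    intro k N
    set B := {x | ((k : ENNReal) + 1)⁻¹ ≤ u x ∧ u (G N x) < ((k : ENNReal) + 1)⁻¹}
    by_contra hpos
    have hBm : MeasurableSet B := (measurableSet_le measurable_const hu).inter
      (measurableSet_lt (hu.comp (G N).measurable) measurable_const)
    have hout : ∀ x ∈ B, ∀ s : ℝ, (N : ℝ) < s → G s x ∉ B := by
      intro x hx s hs hsx
      have hle : u (G s x) ≤ u (G N x) := by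
        simp only [u, forwardIntegral_flow hG]
        exact lintegral_mono_set (Ioi_subset_Ioi hs.le)
      exact absurd (hsx.1.trans hle) (not_le.2 hx.2)
    obtain ⟨s, hsK, hs⟩ := hcons B hBm (pos_iff_ne_zero.2 hpos) (Icc (-(N : ℝ)) N) isCompact_Icc
    obtain ⟨y, hyB, x, hxB, rfl⟩ := nonempty_of_measure_ne_zero hs.ne'
    by_cases h : (N : ℝ) < s
    · exact hout x hxB s h hyB
    · have h' : (N : ℝ) < -s := by
        by_contra hc
        exact hsK ⟨by linarith, by linarith⟩
      refine hout _ hyB (-s) h' ?_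
      rwa [flow_neg_apply_apply hG]
  have hae : ∀ᵐ x ∂μ, ∀ k N : ℕ,
      ¬ (((k : ENNReal) + 1)⁻¹ ≤ u x ∧ u (G N x) < ((k : ENNReal) + 1)⁻¹) := by
    refine ae_all_iff.2 fun k => ae_all_iff.2 fun N => ?_
    rw [ae_iff]
    simpa only [not_not] using hnull k N
  filter_upwards [hae] with x hx
  by_contra hne
  obtain ⟨k, hk⟩ := ENNReal.exists_inv_nat_lt hne
  have hk' : ((k : ENNReal) + 1)⁻¹ ≤ u x :=
    (ENNReal.inv_le_inv.2 le_self_add).trans hk.le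
  obtain ⟨N, hN⟩ := exists_nat_setLIntegral_Ioi_lt (g := fun t => φ (G t x)) (hfin x)
    (δ := ((k : ENNReal) + 1)⁻¹) (by simp)
  rw [← forwardIntegral_flow hG] at hN
  exact hx k N ⟨hk', hN⟩

/-- For a conservative flow, a nonnegative function with finite forward orbital integrals
vanishes almost everywhere. -/
lemma FlowConservative.lintegral_eq_zero_of_forwardIntegral_ne_top {μ : Measure X} [SFinite μ]
    (hcons : FlowConservative μ (fun t => ⇑(G t)))
    (hG : ∀ s t x, G (s + t) x = G s (G t x))
    (hGmp : ∀ t, MeasurePreserving (G t) μ μ)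
    (hGm : Measurable fun p : ℝ × X => G p.1 p.2) {φ : X → ENNReal} (hφ : Measurable φ)
    (hfin : ∀ x, forwardIntegral G φ x ≠ ⊤) : ∫⁻ x, φ x ∂μ = 0 := by
  have h := lintegral_congr_ae (hcons.forwardIntegral_ae_eq_zero hG hGm hφ hfin)
  have hswap : ∫⁻ x, forwardIntegral G φ x ∂μ
      = ∫⁻ t in Ioi (0 : ℝ), ∫⁻ x, φ (G t x) ∂μ :=
    lintegral_lintegral_swap (hφ.comp (hGm.comp measurable_swap)).aemeasurable
  rw [hswap] at h
  simp only [(hGmp _).lintegral_comp hφ, Pi.zero_apply, lintegral_zero, lintegral_const,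
    Measure.restrict_apply_univ, Real.volume_Ioi] at h
  simpa using h

/-- If a set `A` has null returns after time `R`, then almost every point of `A` spends
zero time in `A` after time `R`. -/
lemma measure_setLIntegral_return_ne_zero {μ : Measure X} [SFinite μ]
    (hGm : Measurable fun p : ℝ × X => G p.1 p.2) {A : Set X} (hA : MeasurableSet A) {R : ℝ}
    (hret : ∀ t, R < t → μ (A ∩ G t ⁻¹' A) = 0) :
    μ {x | x ∈ A ∧ ∫⁻ t in Ioi R, A.indicator 1 (G t x) ≠ (0 : ENNReal)} = 0 := by
  have hAm : Measurable (A.indicator (1 : X → ENNReal)) := measurable_one.indicator hA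
  have hzero : ∫⁻ x in A, (∫⁻ t in Ioi R, A.indicator (1 : X → ENNReal) (G t x)) ∂μ = 0 := by
    rw [lintegral_lintegral_swap (f := fun x t => A.indicator (1 : X → ENNReal) (G t x))
      (hAm.comp (hGm.comp measurable_swap)).aemeasurable,
      setLIntegral_congr_fun (g := fun _ => 0) measurableSet_Ioi, lintegral_zero]
    intro t ht
    have hpre : ∀ x, A.indicator (1 : X → ENNReal) (G t x) = (G t ⁻¹' A).indicator 1 x :=
      fun _ => rfl
    simp only [hpre]
    rw [lintegral_indicator_one ((G t).measurable hA),
      Measure.restrict_apply ((G t).measurable hA), inter_comm, hret t ht]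
  have hmeas : Measurable fun x => ∫⁻ t in Ioi R, A.indicator (1 : X → ENNReal) (G t x) :=
    (hAm.comp hGm).lintegral_prod_left'
  rw [lintegral_eq_zero_iff hmeas, EventuallyEq, ae_restrict_iff' hA, ae_iff] at hzero
  simpa using hzero

/-- If from every point of `A` the time spent in `A` after time `R` is zero, then every forward
orbit spends a total time of at most `R + 1` in `A`. -/
lemma forwardIntegral_indicator_le (hG : ∀ s t x, G (s + t) x = G s (G t x))
    {A : Set X} {R : ℝ}
    (hret : ∀ x ∈ A, ∫⁻ t in Ioi R, A.indicator 1 (G t x) = (0 : ENNReal)) (x : X) :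
    forwardIntegral G (A.indicator 1) x ≤ ENNReal.ofReal (R + 1) := by
  by_cases hE : ({t | 0 < t ∧ G t x ∈ A} : Set ℝ).Nonempty
  · set E := {t | 0 < t ∧ G t x ∈ A}
    have hbdd : BddBelow E := ⟨0, fun t ht => ht.1.le⟩
    obtain ⟨s, hs, hslt⟩ := exists_lt_of_csInf_lt hE (lt_add_one (sInf E))
    have htail : ∫⁻ t in Ioi (R + s), A.indicator 1 (G t x) = (0 : ENNReal) := by
      rw [← hret _ hs.2, ← setLIntegral_Ioi_comp_add_right]
      simp only [hG]
    calc forwardIntegral G (A.indicator 1) x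
        ≤ ∫⁻ t, ((Icc (sInf E) (R + s)).indicator 1 t
            + (Ioi (R + s)).indicator (fun t => A.indicator 1 (G t x)) t) := by
          rw [forwardIntegral, ← lintegral_indicator measurableSet_Ioi]
          refine lintegral_mono fun t => ?_
          by_cases ht : t ∈ E
          · have h1 : sInf E ≤ t := csInf_le hbdd ht
            have h2 : (0 : ℝ) < t := ht.1
            by_cases h3 : t ≤ R + s
            · simp [indicator, h1, h2, h3, ht.2]
            · simp [indicator, h2, h3, not_le.1 h3, ht.2]
          · have h0 : (Ioi (0 : ℝ)).indicator
                (fun t => A.indicator (1 : X → ENNReal) (G t x)) t = 0 := by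
              by_cases h2 : 0 < t
              · have h3 : G t x ∉ A := fun h => ht ⟨h2, h⟩
                simp [h3]
              · simp [h2]
            rw [h0]
            exact zero_le
      _ = ENNReal.ofReal (R + s - sInf E) := by
          rw [lintegral_add_left (measurable_one.indicator measurableSet_Icc),
            lintegral_indicator_one measurableSet_Icc, lintegral_indicator measurableSet_Ioi,
            htail, add_zero, Real.volume_Icc]
      _ ≤ ENNReal.ofReal (R + 1) := ENNReal.ofReal_le_ofReal (by linarith)
  · have h0 : forwardIntegral G (A.indicator 1) x = 0 := by
      rw [forwardIntegral, setLIntegral_congr_fun (g := fun _ => 0) measurableSet_Ioi,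
        lintegral_zero]
      intro t ht
      exact indicator_of_notMem (fun h => hE ⟨t, ht, h⟩) _
    rw [h0]
    exact zero_le

end Flow

section Product

variable {Y Z : Type*} [MeasurableSpace Y] [MeasurableSpace Z] {ν : Measure Y} {κ : Measure Z}
  {F : ℝ → Y ≃ᵐ Y} {S : ℝ → Z ≃ᵐ Z}

/-- The forward orbital integral of the fibre measures of `A` is the fibre average of the forward
orbital integral of `A` under the product flow. -/
lemma forwardIntegral_measure_fiber [SFinite κ]
    (hSmp : ∀ t, MeasurePreserving (S t) κ κ)
    (hFm : Measurable fun p : ℝ × Y => F p.1 p.2)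
    (hSm : Measurable fun p : ℝ × Z => S p.1 p.2)
    {A : Set (Y × Z)} (hA : MeasurableSet A) (y : Y) :
    forwardIntegral F (fun y => κ (Prod.mk y ⁻¹' A)) y
      = ∫⁻ z, forwardIntegral (fun t => (F t).prodCongr (S t)) (A.indicator 1) (y, z) ∂κ := by
  have hAm : Measurable (A.indicator (1 : Y × Z → ENNReal)) := measurable_one.indicator hA
  have hmeas : Measurable fun p : Z × ℝ => (F p.2 y, S p.2 p.1) :=
    (hFm.comp (measurable_snd.prodMk measurable_const)).prodMk (hSm.comp measurable_swap)
  have hswap := lintegral_lintegral_swap (μ := κ) (ν := volume.restrict (Ioi (0 : ℝ)))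
    (f := fun z t => A.indicator (1 : Y × Z → ENNReal) (F t y, S t z))
    (hAm.comp hmeas).aemeasurable
  refine Eq.trans ?_ hswap.symm
  refine lintegral_congr fun t => ?_
  have hfib : MeasurableSet (Prod.mk (F t y) ⁻¹' A) := measurable_prodMk_left hA
  beta_reduce
  rw [← (hSmp t).measure_preimage hfib.nullMeasurableSet,
    ← lintegral_indicator_one ((S t).measurable hfib)]
  rfl

lemma FlowConservative.of_prod [SFinite ν] [IsProbabilityMeasure κ]
    (h : FlowConservative (ν.prod κ) (fun t p => (F t p.1, S t p.2))) :
    FlowConservative ν (fun t => ⇑(F t)) := by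
  intro B hB hpos K hK
  obtain ⟨s, hsK, hs⟩ := h (B ×ˢ univ) (hB.prod MeasurableSet.univ)
    (by simpa [Measure.prod_prod] using hpos) K hK
  refine ⟨s, hsK, ?_⟩
  have hsub : (B ×ˢ univ) ∩ (fun p : Y × Z => (F s p.1, S s p.2)) '' (B ×ˢ univ)
      ⊆ (B ∩ F s '' B) ×ˢ univ := by
    rintro _ ⟨⟨h1, -⟩, p, ⟨hp, -⟩, rfl⟩
    exact ⟨⟨h1, p.1, hp, rfl⟩, mem_univ _⟩
  have := hs.trans_le (measure_mono hsub)
  simpa [Measure.prod_prod] using this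

lemma FlowConservative.prod [SFinite ν] [IsProbabilityMeasure κ]
    (hFhom : ∀ s t y, F (s + t) y = F s (F t y))
    (hFmp : ∀ t, MeasurePreserving (F t) ν ν)
    (hFm : Measurable fun p : ℝ × Y => F p.1 p.2)
    (hShom : ∀ s t z, S (s + t) z = S s (S t z))
    (hSmp : ∀ t, MeasurePreserving (S t) κ κ)
    (hSm : Measurable fun p : ℝ × Z => S p.1 p.2)
    (h : FlowConservative ν (fun t => ⇑(F t))) :
    FlowConservative (ν.prod κ) (fun t p => (F t p.1, S t p.2)) := by
  intro A hA hpos K hK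
  by_contra! hcon
  obtain ⟨R, hR⟩ := hK.isBounded.subset_closedBall (0 : ℝ)
  set G : ℝ → Y × Z ≃ᵐ Y × Z := fun t => (F t).prodCongr (S t)
  have hG : ∀ s t x, G (s + t) x = G s (G t x) := fun s t x =>
    Prod.ext (hFhom s t x.1) (hShom s t x.2)
  have hGm : Measurable fun p : ℝ × (Y × Z) => G p.1 p.2 :=
    (hFm.comp (measurable_fst.prodMk (measurable_fst.comp measurable_snd))).prodMk
      (hSm.comp (measurable_fst.prodMk (measurable_snd.comp measurable_snd)))
  have hret : ∀ t, R < t → (ν.prod κ) (A ∩ G t ⁻¹' A) = 0 := by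
    intro t ht
    rw [← flow_image_neg_eq_preimage hG]
    refine le_antisymm (hcon (-t) fun hmem => ?_) zero_le
    have hle := hR hmem
    rw [mem_closedBall_zero_iff, norm_neg, Real.norm_eq_abs] at hle
    exact absurd ((le_abs_self t).trans hle) (not_le.2 ht)
  have hAm : Measurable (A.indicator (1 : Y × Z → ENNReal)) := measurable_one.indicator hA
  set N := {x | x ∈ A ∧ ∫⁻ t in Ioi R, A.indicator 1 (G t x) ≠ (0 : ENNReal)}
  have hNm : MeasurableSet N := hA.inter
    ((hAm.comp hGm).lintegral_prod_left' (measurableSet_singleton (0 : ENNReal)).compl)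
  have hNnull : (ν.prod κ) N = 0 := measure_setLIntegral_return_ne_zero hGm hA hret
  have hA'm : MeasurableSet (A \ N) := hA.diff hNm
  have hA'ret : ∀ x ∈ A \ N, ∫⁻ t in Ioi R, (A \ N).indicator 1 (G t x) = (0 : ENNReal) := by
    intro x hx
    have hx0 : ∫⁻ t in Ioi R, A.indicator 1 (G t x) = (0 : ENNReal) := by
      by_contra hne
      exact hx.2 ⟨hx.1, hne⟩
    refine le_antisymm (hx0 ▸ lintegral_mono fun t => ?_) zero_le
    exact indicator_le_indicator_of_subset sdiff_subset (fun _ => zero_le) _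
  have hfin : ∀ y, forwardIntegral F (fun y => κ (Prod.mk y ⁻¹' (A \ N))) y ≠ ⊤ := by
    intro y
    rw [forwardIntegral_measure_fiber hSmp hFm hSm hA'm]
    refine ((lintegral_mono fun z => forwardIntegral_indicator_le hG hA'ret (y, z)).trans_lt
      ?_).ne
    simp
  have hzero := h.lintegral_eq_zero_of_forwardIntegral_ne_top hFhom hFmp hFm
    (measurable_measure_prodMk_left hA'm) hfin
  rw [← Measure.prod_apply hA'm, measure_sdiff_null hNnull] at hzero
  exact hpos.ne' hzero

end Product

/-- a measure preserving flow `F` on a σ-finite standard measure space is conservative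
iff its product with any probability preserving flow `S` is conservative. -/
theorem flow_conservative_iff_prod {Y Z : Type*} [MeasurableSpace Y] [StandardBorelSpace Y]
    [MeasurableSpace Z] [StandardBorelSpace Z]
    (ν : Measure Y) [SigmaFinite ν] (κ : Measure Z) [IsProbabilityMeasure κ]
    (F : ℝ → Y ≃ᵐ Y) (S : ℝ → Z ≃ᵐ Z)
    (hFhom : ∀ s t : ℝ, ∀ y : Y, F (s + t) y = F s (F t y))
    (hFmp : ∀ t : ℝ, MeasurePreserving (F t) ν ν)
    (hFmeas : Measurable fun p : ℝ × Y => F p.1 p.2)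
    (hShom : ∀ s t : ℝ, ∀ z : Z, S (s + t) z = S s (S t z))
    (hSmp : ∀ t : ℝ, MeasurePreserving (S t) κ κ)
    (hSmeas : Measurable fun p : ℝ × Z => S p.1 p.2) :
    FlowConservative ν (fun t => ⇑(F t)) ↔
      FlowConservative (ν.prod κ) (fun t p => (F t p.1, S t p.2)) := by
  exact ⟨fun h => h.prod hFhom hFmp hFmeas hShom hSmp hSmeas, fun h => h.of_prod⟩
end
end

section
/- Let F = (F_t)_{t∈ℝ} be a measure preserving flow on a σ-finite standard measure space (Y, ν). Then F is rigid if and only if the time-one transformation F_1 is rigid. -/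
open MeasureTheory Filter Set Topology

noncomputable section

/-- The measure of the set by which `B` and its image under `F t` differ. -/
def displacement {Y : Type*} [MeasurableSpace Y] (ν : Measure Y) (F : ℝ → Y ≃ᵐ Y)
    (B : Set Y) (t : ℝ) : ENNReal :=
  ν (symmDiff B (F t '' B))

lemma flow_zero {Y : Type*} [MeasurableSpace Y] {F : ℝ → Y ≃ᵐ Y}
    (hhom : ∀ s t : ℝ, ∀ y : Y, F (s + t) y = F s (F t y)) (y : Y) : F 0 y = y := by
  apply (F 0).injective
  rw [← hhom, add_zero]

lemma flow_image_eq_preimage_neg {Y : Type*} [MeasurableSpace Y] {F : ℝ → Y ≃ᵐ Y}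
    (hhom : ∀ s t : ℝ, ∀ y : Y, F (s + t) y = F s (F t y)) (t : ℝ) (B : Set Y) :
    F t '' B = F (-t) ⁻¹' B := by
  refine congrFun (Set.image_eq_preimage_of_inverse (f := F t) (g := F (-t)) ?_ ?_) B
  · intro y
    rw [← hhom, neg_add_cancel, flow_zero hhom]
  · intro y
    rw [← hhom, add_neg_cancel, flow_zero hhom]

lemma flow_image_add {Y : Type*} [MeasurableSpace Y] {F : ℝ → Y ≃ᵐ Y}
    (hhom : ∀ s t : ℝ, ∀ y : Y, F (s + t) y = F s (F t y)) (s t : ℝ) (B : Set Y) :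
    F (s + t) '' B = F s '' (F t '' B) := by
  rw [Set.image_image]
  exact Set.image_congr fun y _ => hhom s t y

lemma flow_natCast_eq_iterate {Y : Type*} [MeasurableSpace Y] {F : ℝ → Y ≃ᵐ Y}
    (hhom : ∀ s t : ℝ, ∀ y : Y, F (s + t) y = F s (F t y)) (n : ℕ) :
    ⇑(F n) = (⇑(F 1))^[n] := by
  induction n with
  | zero => ext y; simp [flow_zero hhom]
  | succ n ih =>
    ext y
    rw [Nat.cast_succ, hhom, ih, Function.iterate_succ_apply]

lemma measure_image_measurableEquiv {Y : Type*} [MeasurableSpace Y] {ν : Measure Y}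
    {e : Y ≃ᵐ Y} (he : MeasurePreserving e ν ν) (B : Set Y) : ν (e '' B) = ν B := by
  rw [← he.measure_preimage_equiv, e.injective.preimage_image]

lemma measure_symmDiff_image {Y : Type*} [MeasurableSpace Y] {ν : Measure Y}
    {e : Y ≃ᵐ Y} (he : MeasurePreserving e ν ν) (A B : Set Y) :
    ν (symmDiff (e '' A) (e '' B)) = ν (symmDiff A B) := by
  rw [← Set.image_symmDiff e.injective, measure_image_measurableEquiv he]

lemma displacement_add_le {Y : Type*} [MeasurableSpace Y] {ν : Measure Y} {F : ℝ → Y ≃ᵐ Y}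
    (hhom : ∀ s t : ℝ, ∀ y : Y, F (s + t) y = F s (F t y))
    (hmp : ∀ t : ℝ, MeasurePreserving (F t) ν ν) (B : Set Y) (s t : ℝ) :
    displacement ν F B (s + t) ≤ displacement ν F B s + displacement ν F B t := by
  unfold displacement
  rw [flow_image_add hhom, ← measure_symmDiff_image (hmp s) B (F t '' B)]
  exact measure_symmDiff_le _ _ _

lemma measure_symmDiff_flow_image {Y : Type*} [MeasurableSpace Y] {ν : Measure Y}
    {F : ℝ → Y ≃ᵐ Y}
    (hhom : ∀ s t : ℝ, ∀ y : Y, F (s + t) y = F s (F t y))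
    (hmp : ∀ t : ℝ, MeasurePreserving (F t) ν ν) (B : Set Y) (s t : ℝ) :
    ν (symmDiff (F t '' B) (F s '' B)) = displacement ν F B (s - t) := by
  have h : F s '' B = F t '' (F (s - t) '' B) := by
    rw [← flow_image_add hhom, add_sub_cancel]
  rw [h, measure_symmDiff_image (hmp t), displacement]

lemma displacement_natCast_mul_le {Y : Type*} [MeasurableSpace Y] {ν : Measure Y}
    {F : ℝ → Y ≃ᵐ Y}
    (hhom : ∀ s t : ℝ, ∀ y : Y, F (s + t) y = F s (F t y))
    (hmp : ∀ t : ℝ, MeasurePreserving (F t) ν ν) (B : Set Y) (n : ℕ) (t : ℝ) :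
    displacement ν F B (n * t) ≤ n * displacement ν F B t := by
  induction n with
  | zero =>
    have h : F 0 '' B = B := by
      simp [funext (flow_zero hhom)]
    simp [displacement, h]
  | succ n ih =>
    rw [Nat.cast_succ, Nat.cast_succ, add_mul, add_mul, one_mul, one_mul]
    exact (displacement_add_le hhom hmp B _ _).trans (add_le_add_left ih _)

lemma displacement_le_approx {Y : Type*} [MeasurableSpace Y] {ν : Measure Y}
    {F : ℝ → Y ≃ᵐ Y} (hmp : ∀ t : ℝ, MeasurePreserving (F t) ν ν) (A B : Set Y) (t : ℝ) :
    displacement ν F B t ≤ 2 * ν (symmDiff B A) + displacement ν F A t := by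
  unfold displacement
  calc ν (symmDiff B (F t '' B))
      ≤ ν (symmDiff B A) + (ν (symmDiff A (F t '' A)) + ν (symmDiff (F t '' A) (F t '' B))) :=
        (measure_symmDiff_le _ A _).trans (by gcongr; exact measure_symmDiff_le _ _ _)
    _ = 2 * ν (symmDiff B A) + ν (symmDiff A (F t '' A)) := by
        rw [measure_symmDiff_image (hmp t), symmDiff_comm A B]
        ring

lemma tendsto_measure_inter_image_iff {Y ι : Type*} [MeasurableSpace Y] {ν : Measure Y}
    {F : ℝ → Y ≃ᵐ Y} (hmp : ∀ t : ℝ, MeasurePreserving (F t) ν ν) {B : Set Y}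
    (hB : MeasurableSet B) (hfin : ν B < ⊤) {l : Filter ι} {s : ι → ℝ} :
    Tendsto (fun i => ν (B ∩ F (s i) '' B)) l (𝓝 (ν B)) ↔
      Tendsto (fun i => displacement ν F B (s i)) l (𝓝 0) := by
  have hm (i : ι) : MeasurableSet (F (s i) '' B) := (F (s i)).measurableSet_image.2 hB
  have hle (i : ι) : ν (B ∩ F (s i) '' B) ≤ ν B := measure_mono inter_subset_left
  have hne (i : ι) : ν (B ∩ F (s i) '' B) ≠ ⊤ := ((hle i).trans_lt hfin).ne
  have h₁ (i : ι) : ν (B \ F (s i) '' B) = ν B - ν (B ∩ F (s i) '' B) :=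
    ENNReal.eq_sub_of_add_eq (hne i) (by rw [add_comm]; exact measure_inter_add_sdiff B (hm i))
  have h₂ (i : ι) : ν (F (s i) '' B \ B) = ν B - ν (B ∩ F (s i) '' B) := by
    refine ENNReal.eq_sub_of_add_eq (hne i) ?_
    rw [add_comm, inter_comm, measure_inter_add_sdiff _ hB,
      measure_image_measurableEquiv (hmp (s i))]
  have h (i : ι) : displacement ν F B (s i) = 2 * (ν B - ν (B ∩ F (s i) '' B)) := by
    rw [displacement, measure_symmDiff_eq hB.nullMeasurableSet (hm i).nullMeasurableSet, h₁, h₂,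
      two_mul]
  constructor
  · intro ht
    have := ENNReal.Tendsto.const_mul (a := 2)
      (ENNReal.Tendsto.sub (tendsto_const_nhds (x := ν B)) ht (Or.inl hfin.ne)) (by simp)
    simpa [h] using this
  · intro ht
    have hd : Tendsto (fun i => ν B - ν (B ∩ F (s i) '' B)) l (𝓝 0) :=
      tendsto_of_tendsto_of_tendsto_of_le_of_le tendsto_const_nhds ht (fun _ => zero_le)
        fun i => by
          dsimp only
          rw [h, two_mul]
          exact le_self_add
    have := ENNReal.Tendsto.sub (tendsto_const_nhds (x := ν B)) hd (Or.inl hfin.ne)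
    simpa [ENNReal.sub_sub_cancel hfin.ne (hle _)] using this

lemma measurable_measure_symmDiff_flow_image {Y : Type*} [MeasurableSpace Y] {ν : Measure Y}
    [SFinite ν] {F : ℝ → Y ≃ᵐ Y}
    (hhom : ∀ s t : ℝ, ∀ y : Y, F (s + t) y = F s (F t y))
    (hmeas : Measurable fun p : ℝ × Y => F p.1 p.2) {A B : Set Y}
    (hA : MeasurableSet A) (hB : MeasurableSet B) :
    Measurable fun t => ν (symmDiff A (F t '' B)) := by
  have hS : MeasurableSet
      (symmDiff (Prod.snd ⁻¹' A) ((fun p : ℝ × Y => F (-p.1) p.2) ⁻¹' B)) :=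
    (measurable_snd hA).symmDiff
      ((hmeas.comp (measurable_fst.neg.prodMk measurable_snd)) hB)
  simp_rw [flow_image_eq_preimage_neg hhom]
  exact measurable_measure_prodMk_left hS

/-- A jointly measurable measure preserving flow acts continuously on sets of finite measure. -/
lemma tendsto_displacement_zero {Y : Type*} [MeasurableSpace Y] {ν : Measure Y}
    [SFinite ν] [IsSeparable ν] {F : ℝ → Y ≃ᵐ Y}
    (hhom : ∀ s t : ℝ, ∀ y : Y, F (s + t) y = F s (F t y))
    (hmp : ∀ t : ℝ, MeasurePreserving (F t) ν ν)
    (hmeas : Measurable fun p : ℝ × Y => F p.1 p.2) {B : Set Y}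
    (hB : MeasurableSet B) (hfin : ν B < ⊤) :
    Tendsto (displacement ν F B) (𝓝 0) (𝓝 0) := by
  obtain ⟨𝒜, hcount, hdense⟩ := exists_countable_measureDense ν
  have := hcount.to_subtype
  rw [ENNReal.tendsto_nhds_zero]
  intro ε hε
  obtain ⟨δ, hδ, hδε⟩ : ∃ δ : ℝ, 0 < δ ∧ ENNReal.ofReal δ ≤ ε / 2 := by
    obtain ⟨r, hr, hrε⟩ := ENNReal.lt_iff_exists_nnreal_btwn.1 (ENNReal.half_pos hε.ne')
    exact ⟨r, by exact_mod_cast hr, by simpa using hrε.le⟩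
  let S (A : 𝒜) : Set ℝ := {t | ν (symmDiff A (F t '' B)) < ENNReal.ofReal δ}
  have hS (A : 𝒜) : MeasurableSet (S A) :=
    measurable_measure_symmDiff_flow_image hhom hmeas (hdense.measurable A A.2) hB
      measurableSet_Iio
  have hcover : ⋃ A, S A = univ := by
    refine eq_univ_of_forall fun t => ?_
    obtain ⟨A, hA, hlt⟩ := hdense.approx (F t '' B) ((F t).measurableSet_image.2 hB)
      (by rw [measure_image_measurableEquiv (hmp t)]; exact hfin.ne) δ hδ
    exact mem_iUnion.2 ⟨⟨A, hA⟩, by rwa [symmDiff_comm] at hlt⟩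
  obtain ⟨A, hA⟩ : ∃ A, 0 < (volume : Measure ℝ) (S A) :=
    exists_measure_pos_of_not_measure_iUnion_null (by simp [hcover])
  filter_upwards [Measure.sub_mem_nhds_zero_of_addHaar_pos volume (S A) (hS A) hA] with t ht
  obtain ⟨u, hu, v, hv, rfl⟩ := Set.mem_sub.1 ht
  rw [← measure_symmDiff_flow_image hhom hmp]
  calc _ ≤ ν (symmDiff (F v '' B) A) + ν (symmDiff (A : Set Y) (F u '' B)) :=
        measure_symmDiff_le _ _ _
    _ ≤ ε / 2 + ε / 2 := by
        rw [symmDiff_comm]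
        exact add_le_add (hv.le.trans hδε) (hu.le.trans hδε)
    _ = ε := ENNReal.add_halves ε

/-- Convergence of displacements passes from a measure-dense family to all sets of finite
measure. -/
lemma tendsto_displacement_of_measureDense {Y ι : Type*} [MeasurableSpace Y] {ν : Measure Y}
    {F : ℝ → Y ≃ᵐ Y} (hmp : ∀ t : ℝ, MeasurePreserving (F t) ν ν) {𝒜 : Set (Set Y)}
    (hdense : ν.MeasureDense 𝒜) {l : Filter ι} {s : ι → ℝ}
    (hs : ∀ A ∈ 𝒜, ν A ≠ ⊤ → Tendsto (fun i => displacement ν F A (s i)) l (𝓝 0))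
    {B : Set Y} (hB : MeasurableSet B) (hfin : ν B < ⊤) :
    Tendsto (fun i => displacement ν F B (s i)) l (𝓝 0) := by
  rw [ENNReal.tendsto_nhds_zero]
  intro ε hε
  obtain ⟨r, hr, hrε⟩ := ENNReal.lt_iff_exists_nnreal_btwn.1
    (ENNReal.half_pos (ENNReal.half_pos hε.ne').ne')
  obtain ⟨A, hA, hAfin, hlt⟩ := hdense.fin_meas_approx hB hfin.ne r (by exact_mod_cast hr)
  have hle : ν (symmDiff B A) ≤ ε / 2 / 2 := hlt.le.trans (by simpa using hrε.le)
  filter_upwards [ENNReal.tendsto_nhds_zero.1 (hs A hA hAfin) (ε / 2) (ENNReal.half_pos hε.ne')]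
    with i hi
  calc displacement ν F B (s i) ≤ 2 * ν (symmDiff B A) + displacement ν F A (s i) :=
        displacement_le_approx hmp A B _
    _ ≤ (ε / 2 / 2 + ε / 2 / 2) + ε / 2 := by rw [two_mul]; gcongr
    _ = ε := by rw [ENNReal.add_halves, ENNReal.add_halves]

/-- Rigidity times can be replaced by natural numbers: by Dirichlet's theorem some small multiple of
a rigidity time lies close to an integer, and a late enough rigidity time keeps the displacement
of that multiple small. -/
lemma exists_nat_times_tendsto_displacement {Y : Type*} [MeasurableSpace Y] {ν : Measure Y}
    {F : ℝ → Y ≃ᵐ Y}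
    (hhom : ∀ s t : ℝ, ∀ y : Y, F (s + t) y = F s (F t y))
    (hmp : ∀ t : ℝ, MeasurePreserving (F t) ν ν) {s : ℕ → ℝ} (hs : Tendsto s atTop atTop)
    (A : ℕ → Set Y)
    (hzero : ∀ j, Tendsto (displacement ν F (A j)) (𝓝 0) (𝓝 0))
    (hA : ∀ j, Tendsto (fun n => displacement ν F (A j) (s n)) atTop (𝓝 0)) :
    ∃ k : ℕ → ℕ, Tendsto k atTop atTop ∧
      ∀ j, Tendsto (fun N => displacement ν F (A j) (k N)) atTop (𝓝 0) := by
  have key (N : ℕ) : ∃ k : ℕ, N ≤ k ∧ ∃ t : ℝ, |k - t| ≤ 1 / ((N : ℝ) + 1) ∧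
      ∀ j ≤ N, displacement ν F (A j) t ≤ ((N : ENNReal) + 1)⁻¹ := by
    have hev : ∀ᶠ n in atTop, (N : ℝ) + 1 ≤ s n ∧ ∀ j ∈ Finset.range (N + 1),
        ((N + 1 : ℕ) : ENNReal) * displacement ν F (A j) (s n) ≤ ((N : ENNReal) + 1)⁻¹ := by
      refine (hs.eventually_ge_atTop _).and ((Filter.eventually_all_finset _).2 fun j _ => ?_)
      have := ENNReal.Tendsto.const_mul (a := ((N + 1 : ℕ) : ENNReal)) (hA j)
        (Or.inr (ENNReal.natCast_ne_top _))
      rw [mul_zero] at this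
      exact ENNReal.tendsto_nhds_zero.1 this _ (by simp)
    obtain ⟨n, hn, hD⟩ := hev.exists
    obtain ⟨q, hq, hqN, hround⟩ :=
      Real.exists_nat_abs_mul_sub_round_le (s n) (n := N + 1) (Nat.succ_pos N)
    have hq₁ : (1 : ℝ) ≤ q := by exact_mod_cast hq
    have hbound : |q * s n - round (q * s n)| ≤ 1 / ((N : ℝ) + 1) :=
      hround.trans (by push_cast; gcongr; linarith)
    have hone : 1 / ((N : ℝ) + 1) ≤ 1 := by
      rw [div_le_one (by positivity)]
      linarith [(Nat.cast_nonneg N : (0 : ℝ) ≤ N)]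
    have hround_ge : (N : ℝ) ≤ (round (q * s n) : ℤ) := by
      have := (abs_le.1 (hbound.trans hone)).2
      nlinarith [(Nat.cast_nonneg N : (0 : ℝ) ≤ N)]
    have hround_ge' : (N : ℤ) ≤ round (q * s n) := by exact_mod_cast hround_ge
    obtain ⟨k, hk⟩ := Int.eq_ofNat_of_zero_le ((Int.natCast_nonneg N).trans hround_ge')
    rw [hk] at hround_ge' hbound
    refine ⟨k, by exact_mod_cast hround_ge', q * s n, ?_, fun j hj => ?_⟩
    · rw [abs_sub_comm]
      exact_mod_cast hbound
    · refine (displacement_natCast_mul_le hhom hmp _ q (s n)).trans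
        (le_trans ?_ (hD j (Finset.mem_range.2 (Nat.lt_succ_of_le hj))))
      gcongr
  choose k hk t ht hD using key
  refine ⟨k, tendsto_atTop_mono hk tendsto_id, fun j => ?_⟩
  have hdiff : Tendsto (fun N => (k N : ℝ) - t N) atTop (𝓝 0) :=
    squeeze_zero_norm ht tendsto_one_div_add_atTop_nhds_zero_nat
  have hinv : Tendsto (fun N : ℕ => ((N : ENNReal) + 1)⁻¹) atTop (𝓝 0) := by
    simpa [Function.comp_def] using
      ENNReal.tendsto_inv_nat_nhds_zero.comp (tendsto_add_atTop_nat 1)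
  have hsum := ((hzero j).comp hdiff).add hinv
  rw [add_zero] at hsum
  refine tendsto_of_tendsto_of_tendsto_of_le_of_le' tendsto_const_nhds hsum
    (Eventually.of_forall fun _ => zero_le) ?_
  filter_upwards [eventually_ge_atTop j] with N hN
  calc displacement ν F (A j) (k N) = displacement ν F (A j) ((k N - t N) + t N) := by
        rw [sub_add_cancel]
    _ ≤ _ := (displacement_add_le hhom hmp _ _ _).trans (add_le_add_right (hD N j hN) _)

/-- a measure preserving flow on a σ-finite standard measure space is rigid iff
its time-one transformation is rigid. -/
theorem flow_rigid_iff_time_one {Y : Type*} [MeasurableSpace Y] [StandardBorelSpace Y]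
    (ν : Measure Y) [SigmaFinite ν] (F : ℝ → Y ≃ᵐ Y)
    (hhom : ∀ s t : ℝ, ∀ y : Y, F (s + t) y = F s (F t y))
    (hmp : ∀ t : ℝ, MeasurePreserving (F t) ν ν)
    (hmeas : Measurable fun p : ℝ × Y => F p.1 p.2) :
    FlowRigid ν (fun t => ⇑(F t)) ↔
      ∃ n : ℕ → ℕ, Tendsto n atTop atTop ∧
        ∀ B : Set Y, MeasurableSet B → ν B < ⊤ →
          Tendsto (fun k => ν (B ∩ (⇑(F 1))^[n k] '' B)) atTop (𝓝 (ν B)) := by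
  simp_rw [← flow_natCast_eq_iterate hhom]
  constructor
  · rintro ⟨s, hs, hrigid⟩
    obtain ⟨𝒜, hcount, hdense⟩ := exists_countable_measureDense ν
    obtain ⟨A, hA⟩ := (hcount.mono (sep_subset 𝒜 fun A => ν A ≠ ⊤)).exists_eq_range
      hdense.nonempty'
    have hmem (j : ℕ) : A j ∈ 𝒜 ∧ ν (A j) ≠ ⊤ := by
      have : A j ∈ {A ∈ 𝒜 | ν A ≠ ⊤} := hA ▸ mem_range_self j
      exact this
    have hm (j : ℕ) : MeasurableSet (A j) := hdense.measurable _ (hmem j).1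
    have hlt (j : ℕ) : ν (A j) < ⊤ := (hmem j).2.lt_top
    obtain ⟨k, hk, hkA⟩ := exists_nat_times_tendsto_displacement hhom hmp hs A
      (fun j => tendsto_displacement_zero hhom hmp hmeas (hm j) (hlt j))
      (fun j => (tendsto_measure_inter_image_iff hmp (hm j) (hlt j)).1 (hrigid _ (hm j) (hlt j)))
    refine ⟨k, hk, fun B hB hfin => (tendsto_measure_inter_image_iff hmp hB hfin).2 ?_⟩
    refine tendsto_displacement_of_measureDense hmp hdense (fun C hC hCfin => ?_) hB hfin
    obtain ⟨j, rfl⟩ : C ∈ range A := hA ▸ ⟨hC, hCfin⟩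
    exact hkA j
  · rintro ⟨n, hn, hrigid⟩
    exact ⟨fun k => n k, tendsto_natCast_atTop_atTop.comp hn, hrigid⟩
end
end
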